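/- arXiv:1006.1845 — 5 statements merged into one kernel-verified Lean document; each statement's English description precedes it below -/
import Mathlib

section
/- Let n ≥ 1, let r > 0, let x ∈ ℝ^{2n} with |x| < 2r, and let U ⊆ ℝ^{2n} be an open set containing the closed ball of radius 3r centered at 0. Then there exists a compactly supported symplectomorphism τ of ℝ^{2n} such that the closure of {p : τ(p) ≠ p} is contained in U and τ(y) = y + x for all y in the open ball of radius r centered at 0. -/
open MeasureTheory

/-- `ℝ²ⁿ = ℝⁿ × ℝⁿ` with the Euclidean norm. -/
abbrev E (n : ℕ) := EuclideanSpace ℝ (Fin n ⊕ Fin n)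

/-- The standard symplectic form `ω₀((u,v),(u',v')) = ⟨u,v'⟩ - ⟨v,u'⟩` on `ℝ²ⁿ`,
where the first `ℝⁿ` factor is indexed by `Sum.inl` and the second by `Sum.inr`. -/
def omega0 {n : ℕ} (w w' : E n) : ℝ :=
  ∑ i : Fin n, (w (Sum.inl i) * w' (Sum.inr i) - w (Sum.inr i) * w' (Sum.inl i))

/-- A compactly supported symplectomorphism of `(ℝ²ⁿ, ω₀)`: a `C^∞` diffeomorphism
whose support has compact closure and whose derivative preserves `ω₀` everywhere. -/
structure CSSymplectomorphism (n : ℕ) where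
  toFun : E n → E n
  invFun : E n → E n
  left_inv : Function.LeftInverse invFun toFun
  right_inv : Function.RightInverse invFun toFun
  smooth : ContDiff ℝ (⊤ : ℕ∞) toFun
  smooth_inv : ContDiff ℝ (⊤ : ℕ∞) invFun
  compactSupp : IsCompact (closure {p | toFun p ≠ p})
  symplectic : ∀ p w w',
    omega0 (fderiv ℝ toFun p w) (fderiv ℝ toFun p w') = omega0 w w'

open Set Metric Function
open scoped NNReal Topology

/-- A contraction perturbation `p ↦ p + Y p` of the identity is a homeomorphism, with smooth inverse
if `Y` is smooth. -/
theorem LipschitzWith.exists_equiv_id_add {F : Type*} [NormedAddCommGroup F] [NormedSpace ℝ F]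
    [CompleteSpace F] {Y : F → F} {c : ℝ≥0} (hL : LipschitzWith c Y) (hc : c < 1)
    (hY : ContDiff ℝ (⊤ : ℕ∞) Y) :
    ∃ e : F ≃ F, (∀ p, e p = p + Y p) ∧ ContDiff ℝ (⊤ : ℕ∞) e.symm := by
  have happrox : ApproximatesLinearOn (fun p => p + Y p)
      (ContinuousLinearEquiv.refl ℝ F : F →L[ℝ] F) univ c := by
    rw [ApproximatesLinearOn.approximatesLinearOn_iff_lipschitzOnWith, lipschitzOnWith_univ]
    convert hL using 1
    ext p
    simp
  have hcond : Subsingleton F ∨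
      c < ‖((ContinuousLinearEquiv.refl ℝ F).symm : F →L[ℝ] F)‖₊⁻¹ := by
    rcases subsingleton_or_nontrivial F with h | h
    · exact Or.inl h
    · right
      have h1 : ‖((ContinuousLinearEquiv.refl ℝ F).symm : F →L[ℝ] F)‖₊ = 1 :=
        NNReal.eq ContinuousLinearMap.norm_id
      rwa [h1, inv_one]
  let e := happrox.toHomeomorph _ hcond
  have he : (e : F → F) = fun p => p + Y p := rfl
  have hunit : ∀ p, IsUnit (1 + fderiv ℝ Y p) := fun p => by
    have h : ‖-fderiv ℝ Y p‖ < 1 := by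
      rw [norm_neg]
      exact (norm_fderiv_le_of_lipschitz ℝ hL).trans_lt (by exact_mod_cast hc)
    simpa using isUnit_one_sub_of_norm_lt_one h
  have hderiv : ∀ p, HasFDerivAt e
      ((ContinuousLinearEquiv.unitsEquiv ℝ F (hunit p).unit : F ≃L[ℝ] F) : F →L[ℝ] F) p :=
    fun p => (hasFDerivAt_id p).add (hY.differentiable (by simp) p).hasFDerivAt
  exact ⟨e.toEquiv, fun p => rfl, e.contDiff_symm hderiv (he ▸ contDiff_id.add hY)⟩

section SymplecticForm

variable {n : ℕ}

theorem omega0_add_left (u v w : E n) : omega0 (u + v) w = omega0 u w + omega0 v w := by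
  simp only [omega0, ← Finset.sum_add_distrib, PiLp.add_apply]
  exact Finset.sum_congr rfl fun i _ => by ring

theorem omega0_smul_left (s : ℝ) (v w : E n) : omega0 (s • v) w = s * omega0 v w := by
  simp only [omega0, Finset.mul_sum, PiLp.smul_apply, smul_eq_mul]
  exact Finset.sum_congr rfl fun i _ => by ring

theorem omega0_swap (v w : E n) : omega0 v w = -omega0 w v := by
  simp only [omega0, ← Finset.sum_neg_distrib]
  exact Finset.sum_congr rfl fun i _ => by ring

theorem omega0_add_right (u v w : E n) : omega0 u (v + w) = omega0 u v + omega0 u w := by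
  rw [omega0_swap, omega0_add_left, omega0_swap v, omega0_swap w]
  ring

theorem omega0_smul_right (s : ℝ) (v w : E n) : omega0 v (s • w) = s * omega0 v w := by
  rw [omega0_swap, omega0_smul_left, omega0_swap w]
  ring

/-- The functional `w ↦ ω₀(v, w)`. -/
noncomputable def omegaFlat (v : E n) : E n →L[ℝ] ℝ :=
  LinearMap.toContinuousLinearMap
    { toFun := omega0 v
      map_add' := omega0_add_right v
      map_smul' := fun s w => omega0_smul_right s v w }

@[simp]
theorem omegaFlat_apply (v w : E n) : omegaFlat v w = omega0 v w := rfl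

/-- The vector dual to a functional under `ω₀`. -/
noncomputable def omegaSharp (n : ℕ) : (E n →L[ℝ] ℝ) →L[ℝ] E n :=
  LinearMap.toContinuousLinearMap
    { toFun := fun α => WithLp.toLp 2 (Sum.elim
        (fun i => α (EuclideanSpace.single (Sum.inr i) 1))
        (fun i => -α (EuclideanSpace.single (Sum.inl i) 1)))
      map_add' := fun α β => by
        ext (i | i) <;> simp [add_comm]
      map_smul' := fun s α => by
        ext (i | i) <;> simp }

@[simp]
theorem omegaSharp_apply_inl (α : E n →L[ℝ] ℝ) (i : Fin n) :
    omegaSharp n α (Sum.inl i) = α (EuclideanSpace.single (Sum.inr i) 1) := rfl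

@[simp]
theorem omegaSharp_apply_inr (α : E n →L[ℝ] ℝ) (i : Fin n) :
    omegaSharp n α (Sum.inr i) = -α (EuclideanSpace.single (Sum.inl i) 1) := rfl

theorem omega0_omegaSharp (α : E n →L[ℝ] ℝ) (w : E n) : omega0 (omegaSharp n α) w = α w := by
  have hw : w = ∑ k, w k • EuclideanSpace.single k (1 : ℝ) := by
    simpa using ((EuclideanSpace.basisFun (Fin n ⊕ Fin n) ℝ).sum_repr w).symm
  have hα : α w = ∑ k, w k * α (EuclideanSpace.single k 1) := by
    conv_lhs => rw [hw]
    simp only [map_sum, map_smul, smul_eq_mul]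
  rw [hα, Fintype.sum_sum_type, ← Finset.sum_add_distrib]
  simp only [omega0, omegaSharp_apply_inl, omegaSharp_apply_inr]
  exact Finset.sum_congr rfl fun i _ => by ring

theorem omegaSharp_omegaFlat (v : E n) : omegaSharp n (omegaFlat v) = v := by
  ext (i | i) <;> simp [omega0]

/-- The derivative of a Hamiltonian vector field is infinitesimally symplectic. -/
theorem omega0_fderiv_hamiltonian {H : E n → ℝ} (hH : ContDiff ℝ (⊤ : ℕ∞) H) (p w w' : E n) :
    omega0 (fderiv ℝ (fun q => omegaSharp n (fderiv ℝ H q)) p w) w'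
      + omega0 w (fderiv ℝ (fun q => omegaSharp n (fderiv ℝ H q)) p w') = 0 := by
  have hdiff : DifferentiableAt ℝ (fderiv ℝ H) p :=
    (hH.fderiv_right (m := 1) (by norm_cast)).differentiable (by simp) p
  have hd : fderiv ℝ (fun q => omegaSharp n (fderiv ℝ H q)) p
      = (omegaSharp n).comp (fderiv ℝ (fderiv ℝ H) p) :=
    ((omegaSharp n).hasFDerivAt.comp p hdiff.hasFDerivAt).fderiv
  have hsymm : IsSymmSndFDerivAt ℝ H p :=
    hH.contDiffAt.isSymmSndFDerivAt (by simp; norm_cast)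
  rw [hd, omega0_swap w]
  simp only [ContinuousLinearMap.comp_apply, omega0_omegaSharp]
  rw [hsymm.eq w w']
  ring

end SymplecticForm

namespace CSSymplectomorphism

variable {n : ℕ}

/-- The identity. -/
def refl (n : ℕ) : CSSymplectomorphism n where
  toFun := id
  invFun := id
  left_inv _ := rfl
  right_inv _ := rfl
  smooth := contDiff_id
  smooth_inv := contDiff_id
  compactSupp := by simp
  symplectic p w w' := by simp

theorem setOf_comp_ne_subset (f g : E n → E n) :
    {p | f (g p) ≠ p} ⊆ {p | f p ≠ p} ∪ {p | g p ≠ p} := by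
  intro p hp
  by_cases hg : g p = p
  · left
    simpa [hg] using hp
  · exact Or.inr hg

theorem closure_comp_ne_subset (f g : E n → E n) :
    closure {p | f (g p) ≠ p} ⊆ closure {p | f p ≠ p} ∪ closure {p | g p ≠ p} := by
  rw [← closure_union]
  exact closure_mono (setOf_comp_ne_subset f g)

/-- Composition. -/
def comp (σ τ : CSSymplectomorphism n) : CSSymplectomorphism n where
  toFun := fun p => σ.toFun (τ.toFun p)
  invFun := fun p => τ.invFun (σ.invFun p)
  left_inv p := by simp only [σ.left_inv _, τ.left_inv _]
  right_inv p := by simp only [τ.right_inv _, σ.right_inv _]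
  smooth := σ.smooth.comp τ.smooth
  smooth_inv := τ.smooth_inv.comp σ.smooth_inv
  compactSupp := (σ.compactSupp.union τ.compactSupp).of_isClosed_subset isClosed_closure
    (closure_comp_ne_subset _ _)
  symplectic p w w' := by
    have h : fderiv ℝ (fun p => σ.toFun (τ.toFun p)) p
        = (fderiv ℝ σ.toFun (τ.toFun p)).comp (fderiv ℝ τ.toFun p) :=
      fderiv_comp p (σ.smooth.differentiable (by simp) _) (τ.smooth.differentiable (by simp) _)
    simp only [h, ContinuousLinearMap.comp_apply, σ.symplectic, τ.symplectic]

/-- The implicit midpoint (Cayley) map `p - Y p ↦ p + Y p` of an infinitesimally symplectic,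
compactly supported contraction `Y` is a compactly supported symplectomorphism. -/
theorem exists_cayley {Y : E n → E n} {c : ℝ≥0} (hL : LipschitzWith c Y) (hc : c < 1)
    (hY : ContDiff ℝ (⊤ : ℕ∞) Y) (hcs : HasCompactSupport Y)
    (hω : ∀ p w w', omega0 (fderiv ℝ Y p w) w' + omega0 w (fderiv ℝ Y p w') = 0) :
    ∃ τ : CSSymplectomorphism n, closure {p | τ.toFun p ≠ p} ⊆ tsupport Y ∧
      ∀ p, τ.toFun (p - Y p) = p + Y p := by
  obtain ⟨B, hB, hBs⟩ := hL.exists_equiv_id_add hc hY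
  obtain ⟨A, hA, hAs⟩ := hL.neg.exists_equiv_id_add hc hY.neg
  have hA' : ∀ p, A p = p - Y p := fun p => by rw [hA, Pi.neg_apply, sub_eq_add_neg]
  have hsub : closure {p | B (A.symm p) ≠ p} ⊆ tsupport Y := by
    refine closure_mono fun p hp => ?_
    by_contra h
    have h0 : Y p = 0 := by simpa using h
    have h1 : A.symm p = p := by rw [Equiv.symm_apply_eq, hA', h0, sub_zero]
    exact hp (by rw [h1, hB, h0, add_zero])
  have hAd : ∀ p, HasFDerivAt A (ContinuousLinearMap.id ℝ (E n) - fderiv ℝ Y p) p := fun p => by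
    rw [show (A : E n → E n) = fun p => p - Y p from funext hA']
    exact (hasFDerivAt_id p).sub (hY.differentiable (by simp) p).hasFDerivAt
  have hBd : ∀ p, HasFDerivAt B (ContinuousLinearMap.id ℝ (E n) + fderiv ℝ Y p) p := fun p => by
    rw [show (B : E n → E n) = fun p => p + Y p from funext hB]
    exact (hasFDerivAt_id p).add (hY.differentiable (by simp) p).hasFDerivAt
  have hBsm : ContDiff ℝ (⊤ : ℕ∞) B := by
    rw [show (B : E n → E n) = fun p => p + Y p from funext hB]
    exact contDiff_id.add hY
  have hAsm : ContDiff ℝ (⊤ : ℕ∞) A := by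
    rw [show (A : E n → E n) = fun p => p - Y p from funext hA']
    exact contDiff_id.sub hY
  refine ⟨{ toFun := fun p => B (A.symm p)
            invFun := fun p => A (B.symm p)
            left_inv := fun p => by simp
            right_inv := fun p => by simp
            smooth := hBsm.comp hAs
            smooth_inv := hAsm.comp hBs
            compactSupp := hcs.isCompact.of_isClosed_subset isClosed_closure hsub
            symplectic := fun p w w' => ?_ }, hsub, fun p => ?_⟩
  · have hS := (hAs.differentiable (by simp) p).hasFDerivAt
    set S := fderiv ℝ A.symm p
    have hd : fderiv ℝ (fun p => B (A.symm p)) p = _ := ((hBd (A.symm p)).comp p hS).fderiv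
    rw [hd]
    have hid : (ContinuousLinearMap.id ℝ (E n) - fderiv ℝ Y (A.symm p)).comp S
        = ContinuousLinearMap.id ℝ (E n) := by
      refine ((hAd (A.symm p)).comp p hS).unique ?_
      rw [A.self_comp_symm]
      exact hasFDerivAt_id p
    have hv : ∀ v, v = S v + (-1 : ℝ) • fderiv ℝ Y (A.symm p) (S v) := fun v => by
      simpa [sub_eq_add_neg] using (DFunLike.congr_fun hid v).symm
    conv_rhs => rw [hv w, hv w']
    simp only [ContinuousLinearMap.comp_apply, _root_.add_apply,
      ContinuousLinearMap.id_apply, omega0_add_left, omega0_add_right, omega0_smul_left,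
      omega0_smul_right]
    linear_combination 2 * hω (A.symm p) (S w) (S w')
  · change B (A.symm (p - Y p)) = p + Y p
    rw [← hA', A.symm_apply_apply, hB]

end CSSymplectomorphism

/-- A compactly supported Hamiltonian vector field that is constant on a ball. -/
theorem exists_hamiltonian_eq_const_on_ball {n : ℕ} (x : E n) {ρ R : ℝ} (hρ : 0 < ρ)
    (hR : ρ < R) :
    ∃ X : E n → E n, ContDiff ℝ (⊤ : ℕ∞) X ∧ tsupport X ⊆ closedBall 0 R ∧
      (∀ p ∈ ball (0 : E n) ρ, X p = x) ∧
      ∀ p w w', omega0 (fderiv ℝ X p w) w' + omega0 w (fderiv ℝ X p w') = 0 := by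
  let χ : ContDiffBump (0 : E n) := ⟨ρ, R, hρ, hR⟩
  let H : E n → ℝ := fun p => χ p * omegaFlat x p
  have hH : ContDiff ℝ (⊤ : ℕ∞) H := χ.contDiff.mul (omegaFlat x).contDiff
  refine ⟨fun q => omegaSharp n (fderiv ℝ H q), ?_, ?_, fun p hp => ?_,
    omega0_fderiv_hamiltonian hH⟩
  · exact (omegaSharp n).contDiff.comp (hH.fderiv_right (by norm_cast))
  · calc tsupport (fun q => omegaSharp n (fderiv ℝ H q))
        ⊆ tsupport (fderiv ℝ H) := tsupport_comp_subset (map_zero _) _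
      _ ⊆ tsupport H := tsupport_fderiv_subset ℝ
      _ ⊆ tsupport χ := tsupport_mul_subset_left
      _ = closedBall 0 R := χ.tsupport_eq
  · have heq : H =ᶠ[𝓝 p] omegaFlat x := by
      filter_upwards [χ.eventuallyEq_one_of_mem_ball hp] with q hq
      simp [H, hq]
    change omegaSharp n (fderiv ℝ H p) = x
    rw [heq.fderiv_eq, ContinuousLinearMap.fderiv, omegaSharp_omegaFlat]

/-- Translation by `x`, `|x| < 2r`, on the ball `B(0,r)` can be realized by a
compactly supported symplectomorphism supported in any open set containing
`closedBall 0 (3r)`. -/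
theorem exists_csSymplectomorphism_translation
    (n : ℕ) (hn : 1 ≤ n) (r : ℝ) (hr : 0 < r) (x : E n) (hx : ‖x‖ < 2 * r)
    (U : Set (E n)) (hU : IsOpen U) (hball : Metric.closedBall (0 : E n) (3 * r) ⊆ U) :
    ∃ τ : CSSymplectomorphism n, closure {p | τ.toFun p ≠ p} ⊆ U ∧
      ∀ y ∈ Metric.ball (0 : E n) r, τ.toFun y = y + x := by
  have hρ : 0 < r + ‖x‖ := by positivity
  obtain ⟨X, hX, hXs, hXc, hXω⟩ :=
    exists_hamiltonian_eq_const_on_ball x hρ (show r + ‖x‖ < 3 * r by linarith)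
  have hXcs : HasCompactSupport X :=
    (isCompact_closedBall _ _).of_isClosed_subset (isClosed_tsupport X) hXs
  obtain ⟨C, hC⟩ := hX.lipschitzWith_of_hasCompactSupport hXcs (by simp)
  obtain ⟨N, hN⟩ := exists_nat_gt C
  have hN0 : (0 : ℝ) < N := lt_of_le_of_lt C.2 (by exact_mod_cast hN)
  let s : ℝ≥0 := (2 * N)⁻¹
  have hs : (s : ℝ) = (2 * (N : ℝ))⁻¹ := by simp [s]
  have hsN : 2 * s * N = (1 : ℝ) := by rw [hs]; field_simp
  have hsC : s * C < 1 := by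
    have h1 : (C : ℝ) < N := by exact_mod_cast hN
    have h2 : (0 : ℝ) < s := by rw [hs]; positivity
    have h3 : (s : ℝ) * C < 1 := by nlinarith
    exact_mod_cast h3
  have hYs : tsupport ((s : ℝ) • X) ⊆ tsupport X := tsupport_smul_subset_right (fun _ => (s : ℝ)) X
  have hYL : LipschitzWith (s * C) ((s : ℝ) • X) :=
    LipschitzWith.of_dist_le_mul fun p q => by
      have h := hC.dist_le_mul p q
      simp only [Pi.smul_apply, dist_smul₀, NNReal.coe_mul, mul_assoc]
      gcongr
      simp
  obtain ⟨σ, hσs, hσ⟩ := CSSymplectomorphism.exists_cayley hYL hsC (contDiff_const.smul hX)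
    (hXcs.isCompact.of_isClosed_subset (isClosed_tsupport _) hYs) (fun p w w' => by
      rw [fderiv_const_smul (hX.differentiable (by simp) p)]
      simp only [_root_.smul_apply, omega0_smul_left, omega0_smul_right]
      linear_combination (s : ℝ) * hXω p w w')
  have hstep : ∀ q, q + (s : ℝ) • x ∈ ball (0 : E n) (r + ‖x‖) →
      σ.toFun q = q + (2 * s : ℝ) • x := fun q hq => by
    have h := hσ (q + (s : ℝ) • x)
    rw [Pi.smul_apply, hXc _ hq, add_sub_cancel_right] at h
    rw [h]
    module
  have hiter : ∀ k : ℕ, k ≤ N → ∃ τ : CSSymplectomorphism n,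
      closure {p | τ.toFun p ≠ p} ⊆ closedBall 0 (3 * r) ∧
      ∀ y ∈ ball (0 : E n) r, τ.toFun y = y + (2 * s * k : ℝ) • x := by
    intro k
    induction k with
    | zero => exact fun _ => ⟨.refl n, by simp [CSSymplectomorphism.refl],
        fun y _ => by simp [CSSymplectomorphism.refl]⟩
    | succ k ih =>
      intro hk
      obtain ⟨τ, hτs, hτ⟩ := ih (by omega)
      refine ⟨σ.comp τ, (CSSymplectomorphism.closure_comp_ne_subset σ.toFun τ.toFun).trans
        (union_subset (hσs.trans (hYs.trans hXs)) hτs), fun y hy => ?_⟩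
      change σ.toFun (τ.toFun y) = _
      rw [hτ y hy, hstep]
      · push_cast
        module
      · have hk' : (k : ℝ) + 1 ≤ N := by exact_mod_cast hk
        have h0 : (0 : ℝ) ≤ 2 * s * k + s := by positivity
        have h1 : 2 * s * k + s ≤ (1 : ℝ) := by nlinarith [s.2]
        rw [mem_ball_zero_iff] at hy ⊢
        rw [add_assoc, ← add_smul]
        calc ‖y + (2 * s * k + s : ℝ) • x‖ ≤ ‖y‖ + ‖(2 * s * k + s : ℝ) • x‖ := norm_add_le _ _
          _ = ‖y‖ + (2 * s * k + s) * ‖x‖ := by rw [norm_smul, Real.norm_of_nonneg h0]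
          _ < r + ‖x‖ := by nlinarith [norm_nonneg x]
  obtain ⟨τ, hτs, hτ⟩ := hiter N le_rfl
  exact ⟨τ, hτs.trans hball, fun y hy => by rw [hτ y hy, hsN, one_smul]⟩
end

section
/- Let n ≥ 1 and let H₀ be a closed subspace of L²(ℝ^{2n}, λ; ℂ), not equal to {0}, such that Π(φ)H₀ ⊆ H₀ for every compactly supported symplectomorphism φ of ℝ^{2n}. Then for every nonempty open set U ⊆ ℝ^{2n} there exists f ∈ H₀ which is not almost everywhere zero and vanishes almost everywhere outside U. -/
open MeasureTheory

open Set Filter Metric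
open scoped RealInnerProductSpace

/-- The complex structure `(u, v) ↦ (-v, u)` on `ℝ²ⁿ`. -/
noncomputable def complexStructure (n : ℕ) : E n →L[ℝ] E n :=
  LinearMap.toContinuousLinearMap
    { toFun := fun w => WithLp.toLp 2 (Sum.elim (fun i => -w (Sum.inr i)) fun i => w (Sum.inl i))
      map_add' := by
        intro x y
        ext i
        rcases i with i | i <;> simp [add_comm]
      map_smul' := by
        intro c x
        ext i
        rcases i with i | i <;> simp }

@[simp]
theorem complexStructure_inl {n : ℕ} (w : E n) (i : Fin n) :
    complexStructure n w (Sum.inl i) = -w (Sum.inr i) := rfl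

@[simp]
theorem complexStructure_inr {n : ℕ} (w : E n) (i : Fin n) :
    complexStructure n w (Sum.inr i) = w (Sum.inl i) := rfl

theorem omega0_eq_inner {n : ℕ} (w w' : E n) : omega0 w w' = ⟪complexStructure n w, w'⟫ := by
  simp only [omega0, PiLp.inner_apply, Fintype.sum_sum_type, complexStructure_inl,
    complexStructure_inr, RCLike.inner_apply, conj_trivial, ← Finset.sum_add_distrib]
  exact Finset.sum_congr rfl fun i _ => by ring

@[simp]
theorem complexStructure_apply_apply {n : ℕ} (w : E n) :
    complexStructure n (complexStructure n w) = -w := by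
  ext i
  rcases i with i | i <;> simp

@[simp]
theorem inner_complexStructure_self {n : ℕ} (w : E n) : ⟪complexStructure n w, w⟫ = 0 := by
  rw [← omega0_eq_inner, omega0]
  exact Finset.sum_eq_zero fun i _ => by ring

theorem inner_complexStructure_right {n : ℕ} (w w' : E n) :
    ⟪w, complexStructure n w'⟫ = -⟪complexStructure n w, w'⟫ := by
  have h := inner_complexStructure_self (w + w')
  simp only [map_add, inner_add_left, inner_add_right, inner_complexStructure_self] at h
  rw [real_inner_comm]
  linarith

/-- A linear endomorphism preserving the symplectic form has determinant `±1`. -/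
theorem abs_det_eq_one_of_omega0 {n : ℕ} (L : E n →L[ℝ] E n)
    (hL : ∀ w w', omega0 (L w) (L w') = omega0 w w') : |L.det| = 1 := by
  let A : E n →ₗ[ℝ] E n := L.toLinearMap
  let J : E n →ₗ[ℝ] E n := (complexStructure n).toLinearMap
  have hJ : J.det * J.det = (-1) ^ Module.finrank ℝ (E n) := by
    rw [← LinearMap.det_comp]
    have : J ∘ₗ J = (-1 : ℝ) • LinearMap.id := by
      ext1 w
      simp [J]
    rw [this, LinearMap.det_smul, LinearMap.det_id, mul_one]
  have hJ0 : J.det ≠ 0 := by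
    intro h
    rw [h, mul_zero] at hJ
    exact pow_ne_zero _ (by norm_num) hJ.symm
  have hadj : (LinearMap.adjoint A).det = A.det := by
    let b := stdOrthonormalBasis ℝ (E n)
    rw [← LinearMap.det_toMatrix b.toBasis, LinearMap.toMatrix_adjoint, Matrix.det_conjTranspose,
      LinearMap.det_toMatrix, star_trivial]
  have hcomp : LinearMap.adjoint A ∘ₗ J ∘ₗ A = J := by
    ext1 w
    refine ext_inner_right ℝ fun w' => ?_
    have := hL w w'
    rw [omega0_eq_inner, omega0_eq_inner] at this
    simpa [LinearMap.adjoint_inner_left] using! this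
  have hdet := congrArg LinearMap.det hcomp
  rw [LinearMap.det_comp, LinearMap.det_comp, hadj] at hdet
  have hsq : A.det * A.det = 1 := by
    apply mul_left_cancel₀ hJ0
    linear_combination hdet
  have : |A.det| * |A.det| = 1 := by rw [abs_mul_abs_self, hsq]
  change |A.det| = 1
  nlinarith [abs_nonneg A.det]

theorem CSSymplectomorphism.measurePreserving_invFun {n : ℕ} (φ : CSSymplectomorphism n) :
    MeasurePreserving φ.invFun (volume : Measure (E n)) volume := by
  refine ⟨φ.smooth_inv.continuous.measurable, Measure.ext fun s hs => ?_⟩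
  rw [Measure.map_apply φ.smooth_inv.continuous.measurable hs,
    ← image_eq_preimage_of_inverse φ.left_inv φ.right_inv,
    ← lintegral_abs_det_fderiv_eq_addHaar_image volume hs
      (fun x _ => ((φ.smooth.differentiable (by simp) x).hasFDerivAt).hasFDerivWithinAt)
      φ.left_inv.injective.injOn]
  simp [abs_det_eq_one_of_omega0 _ (φ.symplectic _)]

/-- The rotation about `c` in the direction of the complex structure, with an angle depending on
the squared distance to `c`; this is the flow of a radial Hamiltonian. -/
noncomputable def twist {n : ℕ} (θ : ℝ → ℝ) (c x : E n) : E n :=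
  c + (Real.cos (θ (‖x - c‖ ^ 2)) • (x - c) +
    Real.sin (θ (‖x - c‖ ^ 2)) • complexStructure n (x - c))

theorem norm_cos_add_sin_complexStructure {n : ℕ} (t : ℝ) (w : E n) :
    ‖Real.cos t • w + Real.sin t • complexStructure n w‖ ^ 2 = ‖w‖ ^ 2 := by
  rw [← real_inner_self_eq_norm_sq, ← real_inner_self_eq_norm_sq]
  simp only [inner_add_left, inner_add_right, real_inner_smul_left, real_inner_smul_right,
    inner_complexStructure_right, complexStructure_apply_apply, inner_complexStructure_self,
    inner_neg_left]
  linear_combination ⟪w, w⟫ * Real.sin_sq_add_cos_sq t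

theorem twist_neg_twist {n : ℕ} (θ : ℝ → ℝ) (c x : E n) :
    twist (fun t => -θ t) c (twist θ c x) = x := by
  have h : twist θ c x - c = Real.cos (θ (‖x - c‖ ^ 2)) • (x - c) +
      Real.sin (θ (‖x - c‖ ^ 2)) • complexStructure n (x - c) := add_sub_cancel_left _ _
  rw [twist, h, norm_cos_add_sin_complexStructure]
  set t := θ (‖x - c‖ ^ 2)
  have hx : x = c + (x - c) := (add_sub_cancel c x).symm
  conv_rhs => rw [hx]
  simp only [map_add, map_smul, complexStructure_apply_apply, Real.cos_neg, Real.sin_neg]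
  have h1 := Real.sin_sq_add_cos_sq t
  have : (x - c) = (Real.sin t ^ 2 + Real.cos t ^ 2) • (x - c) := by rw [h1, one_smul]
  conv_rhs => rw [this]
  module

theorem contDiff_twist {n : ℕ} {θ : ℝ → ℝ} (hθ : ContDiff ℝ (⊤ : ℕ∞) θ) (c : E n) :
    ContDiff ℝ (⊤ : ℕ∞) (twist θ c) := by
  have hx : ContDiff ℝ (⊤ : ℕ∞) fun x : E n => x - c := contDiff_id.sub contDiff_const
  have ht : ContDiff ℝ (⊤ : ℕ∞) fun x : E n => θ (‖x - c‖ ^ 2) := hθ.comp (hx.norm_sq ℝ)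
  exact contDiff_const.add ((ht.cos.smul hx).add
    (ht.sin.smul ((complexStructure n).contDiff.comp hx)))

theorem fderiv_twist_apply {n : ℕ} {θ : ℝ → ℝ} (hθ : ContDiff ℝ (⊤ : ℕ∞) θ) (c x w : E n) :
    fderiv ℝ (twist θ c) x w =
      Real.cos (θ (‖x - c‖ ^ 2)) • w + Real.sin (θ (‖x - c‖ ^ 2)) • complexStructure n w +
      (2 * deriv θ (‖x - c‖ ^ 2) * ⟪x - c, w⟫) •
        (Real.cos (θ (‖x - c‖ ^ 2)) • complexStructure n (x - c) -
          Real.sin (θ (‖x - c‖ ^ 2)) • (x - c)) := by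
  have hx : HasFDerivAt (fun x : E n => x - c) (ContinuousLinearMap.id ℝ (E n)) x :=
    (hasFDerivAt_id x).sub_const c
  have ht := (hθ.differentiable (by simp) (‖x - c‖ ^ 2)).hasDerivAt.comp_hasFDerivAt x hx.norm_sq
  have h := ((ht.cos.smul hx).add
    (ht.sin.smul ((complexStructure n).hasFDerivAt.comp x hx))).const_add c
  have h' : HasFDerivAt (twist θ c) _ x := h
  rw [h'.fderiv]
  simp [-map_sub]
  module

theorem omega0_fderiv_twist {n : ℕ} {θ : ℝ → ℝ} (hθ : ContDiff ℝ (⊤ : ℕ∞) θ) (c x w w' : E n) :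
    omega0 (fderiv ℝ (twist θ c) x w) (fderiv ℝ (twist θ c) x w') = omega0 w w' := by
  simp only [fderiv_twist_apply hθ, omega0_eq_inner]
  set t := θ (‖x - c‖ ^ 2)
  set y := x - c
  simp only [map_add, map_sub, map_smul, complexStructure_apply_apply, inner_add_left,
    inner_add_right, inner_sub_left, inner_sub_right, inner_neg_left,
    real_inner_smul_left, real_inner_smul_right, inner_complexStructure_right,
    inner_complexStructure_self]
  have hw : ⟪complexStructure n w, y⟫ = -⟪complexStructure n y, w⟫ := by
    rw [← inner_complexStructure_right, real_inner_comm]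
  rw [hw, real_inner_comm y w]
  linear_combination ⟪complexStructure n w, w'⟫ * Real.sin_sq_add_cos_sq t

theorem twist_eq_self {n : ℕ} {θ : ℝ → ℝ} {c x : E n} (h : θ (‖x - c‖ ^ 2) = 0) :
    twist θ c x = x := by
  simp [twist, h]

/-- The twist about `c` as a compactly supported symplectomorphism. -/
noncomputable def twistSymplectomorphism {n : ℕ} (θ : ℝ → ℝ) (hθ : ContDiff ℝ (⊤ : ℕ∞) θ) (R : ℝ)
    (hR : ∀ t, R ≤ t → θ t = 0) (c : E n) : CSSymplectomorphism n where
  toFun := twist θ c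
  invFun := twist (fun t => -θ t) c
  left_inv := twist_neg_twist θ c
  right_inv x := by simpa using twist_neg_twist (fun t => -θ t) c x
  smooth := contDiff_twist hθ c
  smooth_inv := contDiff_twist hθ.neg c
  compactSupp := by
    refine (isCompact_closedBall c (|R| + 1)).of_isClosed_subset isClosed_closure
      (closure_minimal (fun x hx => ?_) isClosed_closedBall)
    by_contra h
    rw [mem_closedBall, dist_eq_norm, not_le] at h
    refine hx (twist_eq_self (hR _ ?_))
    nlinarith [le_abs_self R, abs_nonneg R]
  symplectic := omega0_fderiv_twist hθ c

/-- For every ball there is a compactly supported symplectomorphism which is the point reflection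
in the centre on that ball, and is the identity outside the concentric ball of twice the radius. -/
theorem exists_symplectomorphism_pointReflection {n : ℕ} (c : E n) {r : ℝ} (hr : 0 < r) :
    ∃ φ : CSSymplectomorphism n, (∀ x ∈ ball c r, φ.invFun x = c + c - x) ∧
      ∀ x ∉ ball c (2 * r), φ.invFun x = x := by
  let θ : ℝ → ℝ := fun t => -(Real.pi * Real.smoothTransition (2 - t / r ^ 2))
  have hθ : ContDiff ℝ (⊤ : ℕ∞) θ := by
    have h : ContDiff ℝ (⊤ : ℕ∞) Real.smoothTransition := Real.smoothTransition.contDiff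
    fun_prop
  have hr2 : 0 < r ^ 2 := by positivity
  have hzero : ∀ t, 2 * r ^ 2 ≤ t → θ t = 0 := by
    intro t ht
    have : 2 ≤ t / r ^ 2 := by rwa [le_div_iff₀ hr2]
    simp [θ, Real.smoothTransition.zero_of_nonpos (sub_nonpos.2 this)]
  refine ⟨twistSymplectomorphism θ hθ (2 * r ^ 2) hzero c, fun x hx => ?_, fun x hx => ?_⟩
  · rw [mem_ball, dist_eq_norm] at hx
    have : ‖x - c‖ ^ 2 / r ^ 2 ≤ 1 := by
      rw [div_le_one hr2]
      gcongr
    have h1 : θ (‖x - c‖ ^ 2) = -Real.pi := by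
      simp [θ, Real.smoothTransition.one_of_one_le (show 1 ≤ 2 - ‖x - c‖ ^ 2 / r ^ 2 by linarith)]
    simp only [twistSymplectomorphism, twist, h1, neg_neg, Real.cos_pi, Real.sin_pi]
    module
  · rw [mem_ball, dist_eq_norm, not_lt] at hx
    have h0 : -θ (‖x - c‖ ^ 2) = 0 := by rw [hzero _ (by nlinarith), neg_zero]
    exact twist_eq_self (θ := fun t => -θ t) h0

/-- An `L²` function invariant under a nonzero translation is zero. -/
theorem Lp_eq_zero_of_translation_invariant {n : ℕ} (f : Lp ℂ 2 (volume : Measure (E n)))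
    {v : E n} (hv : v ≠ 0) (h : ∀ᵐ x ∂(volume : Measure (E n)), f (x + v) = f x) : f = 0 := by
  let ρ : E n → ENNReal := fun x => ‖f x‖ₑ ^ 2
  have hρ : Measurable ρ := ((Lp.stronglyMeasurable f).enorm).pow_const 2
  let μ : Measure (E n) := volume.withDensity ρ
  have hfin : IsFiniteMeasure μ := by
    refine isFiniteMeasure_withDensity ?_
    have h2 := lintegral_rpow_enorm_lt_top_of_eLpNorm_lt_top two_ne_zero ENNReal.ofNat_ne_top
      (Lp.memLp f).2
    simpa [ρ] using h2.ne
  have hT : MeasurePreserving (fun x : E n => x + v) μ μ := by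
    have hT0 := measurePreserving_add_right (volume : Measure (E n)) v
    refine ⟨hT0.measurable, Measure.ext fun s hs => ?_⟩
    rw [Measure.map_apply hT0.measurable hs, withDensity_apply _ hs,
      withDensity_apply _ (hT0.measurable hs), ← hT0.setLIntegral_comp_preimage hs hρ]
    refine lintegral_congr_ae (ae_restrict_of_ae ?_)
    filter_upwards [h] with x hx
    simp [ρ, hx]
  have hball : ∀ R : ℕ, μ (ball 0 R) = 0 := by
    intro R
    rw [measure_eq_zero_iff_ae_notMem]
    filter_upwards [hT.conservative.ae_mem_imp_frequently_image_mem
      (measurableSet_ball (x := (0 : E n)) (ε := R)).nullMeasurableSet] with x hx hxR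
    refine hx hxR ?_
    have htend : Tendsto (fun k : ℕ => (k : ℝ) * ‖v‖) atTop atTop :=
      tendsto_natCast_atTop_atTop.atTop_mul_const (norm_pos_iff.2 hv)
    filter_upwards [htend.eventually_ge_atTop (R + ‖x‖)] with k hk hmem
    have hit : (fun x : E n => x + v)^[k] x = x + (k : ℝ) • v := by
      rw [add_right_iterate_apply, Nat.cast_smul_eq_nsmul]
    rw [hit, mem_ball_zero_iff] at hmem
    have h1 : ‖(k : ℝ) • v‖ ≤ ‖x + (k : ℝ) • v‖ + ‖x‖ := by
      simpa using norm_sub_le (x + (k : ℝ) • v) x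
    rw [norm_smul, Real.norm_natCast] at h1
    linarith
  have huniv : μ univ = 0 := by
    rw [← iUnion_ball_nat (0 : E n)]
    exact measure_iUnion_null hball
  rw [withDensity_apply _ MeasurableSet.univ, Measure.restrict_univ,
    lintegral_eq_zero_iff hρ] at huniv
  rw [Lp.eq_zero_iff_ae_eq_zero]
  filter_upwards [huniv] with x hx
  simpa [ρ] using hx

/-- If a nonzero closed subspace `H₀ ≤ L²(ℝ²ⁿ)` is invariant under the
representation `Π(φ)f = f ∘ φ⁻¹` of the group of compactly supported
symplectomorphisms, then for every nonempty open `U` it contains a nonzero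
function vanishing a.e. outside `U`. -/
theorem invariant_subspace_contains_small_support
    (n : ℕ) (hn : 1 ≤ n)
    (H₀ : Submodule ℂ (Lp ℂ 2 (volume : Measure (E n))))
    (hclosed : IsClosed (H₀ : Set (Lp ℂ 2 (volume : Measure (E n)))))
    (hne : H₀ ≠ ⊥)
    (hinv : ∀ φ : CSSymplectomorphism n, ∀ f ∈ H₀,
      ∀ g : Lp ℂ 2 (volume : Measure (E n)),
        (g : E n → ℂ) =ᵐ[volume] (fun p => f (φ.invFun p)) → g ∈ H₀)
    (U : Set (E n)) (hU : IsOpen U) (hUne : U.Nonempty) :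
    ∃ f ∈ H₀, f ≠ 0 ∧ ∀ᵐ p ∂(volume : Measure (E n)), p ∉ U → (f : E n → ℂ) p = 0 := by
  by_contra! hcon
  obtain ⟨c, hc⟩ := hUne
  obtain ⟨ε, hε, hεU⟩ := Metric.isOpen_iff.1 hU c hc
  obtain ⟨r, hr, hrε⟩ : ∃ r > 0, 2 * r = ε := ⟨ε / 2, by positivity, by ring⟩
  subst hrε
  have hcomp : ∀ φ : CSSymplectomorphism n, ∀ f ∈ H₀, ∃ g ∈ H₀,
      ∀ᵐ x ∂(volume : Measure (E n)), g x = f (φ.invFun x) := fun φ f hf =>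
    ⟨Lp.compMeasurePreserving φ.invFun φ.measurePreserving_invFun f,
      hinv φ f hf _ (Lp.coeFn_compMeasurePreserving f φ.measurePreserving_invFun),
      Lp.coeFn_compMeasurePreserving f φ.measurePreserving_invFun⟩
  have hcenter : ∀ f ∈ H₀, ∀ᵐ x ∂(volume : Measure (E n)), x ∈ ball c r →
      f (c + c - x) = f x := by
    intro f hf
    obtain ⟨φ, hφ, hφ'⟩ := exists_symplectomorphism_pointReflection c hr
    obtain ⟨g, hg, hgf⟩ := hcomp φ f hf
    have hzero : g - f = 0 := by
      by_contra hne0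
      refine hcon _ (H₀.sub_mem hg hf) hne0 ?_
      filter_upwards [Lp.coeFn_sub g f, hgf] with x hx hgx ⟨hxU, hx0⟩
      rw [hx, Pi.sub_apply, hgx, hφ' x fun h => hxU (hεU h), sub_self] at hx0
      exact hx0 rfl
    rw [sub_eq_zero.1 hzero] at hgf
    filter_upwards [hgf] with x hx hxr
    rw [hx, hφ x hxr]
  have hreflect : ∀ f ∈ H₀, ∀ q : E n, ∀ᵐ x ∂(volume : Measure (E n)), x ∈ ball q r →
      f (q + q - x) = f x := by
    intro f hf q
    obtain ⟨ψ, hψ, -⟩ := exists_symplectomorphism_pointReflection ((1 / 2 : ℝ) • (q + c))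
      (show 0 < r + ‖q - c‖ by positivity)
    obtain ⟨g, hg, hgf⟩ := hcomp ψ f hf
    have hψ' : ∀ x ∈ ball c r, ψ.invFun x = q + c - x := by
      intro x hx
      rw [hψ x]
      · module
      · rw [mem_ball, dist_eq_norm] at hx ⊢
        have h1 : x - (1 / 2 : ℝ) • (q + c) = (x - c) - (1 / 2 : ℝ) • (q - c) := by module
        have h2 := norm_sub_le (x - c) ((1 / 2 : ℝ) • (q - c))
        rw [norm_smul, Real.norm_of_nonneg (by norm_num)] at h2
        rw [h1]
        linarith [norm_nonneg (q - c)]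
    have hsub : ∀ a : E n, Measure.QuasiMeasurePreserving (fun x : E n => a - x) volume volume :=
      fun a => (Measure.measurePreserving_sub_left volume a).quasiMeasurePreserving
    have hx : ∀ᵐ x ∂(volume : Measure (E n)), x ∈ ball c r → f (q - c + x) = f (q + c - x) := by
      filter_upwards [hgf, (hsub (c + c)).ae hgf, hcenter g hg] with x h1 h2 h3 hxr
      have hxr' : c + c - x ∈ ball c r := by
        rw [mem_ball, dist_eq_norm] at hxr ⊢
        rwa [show c + c - x - c = -(x - c) by abel, norm_neg]
      rw [hψ' x hxr] at h1
      rw [hψ' _ hxr', h3 hxr, h1] at h2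
      rw [h2]
      congr 1
      abel
    filter_upwards [(hsub (q + c)).ae hx] with y hy hyr
    have hy' : q + c - y ∈ ball c r := by
      rw [mem_ball, dist_eq_norm] at hyr ⊢
      rwa [show q + c - y - c = -(y - q) by abel, norm_neg]
    have := hy hy'
    rwa [show q - c + (q + c - y) = q + q - y by abel,
      show q + c - (q + c - y) = y by abel] at this
  obtain ⟨f, hf, hf0⟩ := H₀.exists_mem_ne_zero_of_ne_bot hne
  have : Nonempty (Fin n ⊕ Fin n) := ⟨Sum.inl ⟨0, hn⟩⟩
  obtain ⟨v, hv⟩ := exists_norm_eq (E n) (half_pos hr).le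
  refine hf0 (Lp_eq_zero_of_translation_invariant f (v := v) ?_ ?_)
  · rw [← norm_pos_iff]
    linarith
  have hT := (measurePreserving_add_right (volume : Measure (E n)) v).quasiMeasurePreserving
  let s := TopologicalSpace.denseSeq (E n)
  filter_upwards [ae_all_iff.2 fun k => hreflect f hf (s k),
    ae_all_iff.2 fun k => hT.ae (hreflect f hf (s k + (1 / 2 : ℝ) • v))] with x h1 h2
  obtain ⟨k, hk⟩ := (TopologicalSpace.denseRange_denseSeq (E n)).exists_dist_lt x (half_pos hr)
  have hk1 : x ∈ ball (s k) r := mem_ball.2 (hk.trans (half_lt_self hr))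
  have hk2 : x + v ∈ ball (s k + (1 / 2 : ℝ) • v) r := by
    rw [dist_eq_norm] at hk
    rw [mem_ball, dist_eq_norm,
      show x + v - (s k + (1 / 2 : ℝ) • v) = (x - s k) + (1 / 2 : ℝ) • v by module]
    refine (norm_add_le _ _).trans_lt ?_
    rw [norm_smul, hv, Real.norm_of_nonneg (by norm_num)]
    change ‖x - s k‖ < r / 2 at hk
    linarith
  rw [← h2 k hk2, ← h1 k hk1]
  congr 1
  module
end

section
/- Let n ≥ 1. Every closed subspace H₀ of L²(ℝ^{2n}, λ; ℂ) satisfying Π(φ)H₀ ⊆ H₀ for every compactly supported symplectomorphism φ of ℝ^{2n} is either {0} or all of L²(ℝ^{2n}, λ; ℂ). (This is the case M = ℝ^{2n}, ω = ω₀ of the theorem that the natural representation of the group of compactly supported symplectomorphisms on the orthogonal complement of the constants in L²(M, ωⁿ) is irreducible; for Lebesgue measure, which is infinite, no nonzero constants lie in L², so the complement is all of L².) -/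
open MeasureTheory

namespace CSSymplectomorphism

open Metric Filter Topology

variable {n : ℕ}

/-- The standard complex structure `(u, v) ↦ (-v, u)` on `ℝ²ⁿ`. -/
noncomputable def complexStructure (n : ℕ) : E n →L[ℝ] E n :=
  LinearMap.toContinuousLinearMap
    { toFun := fun w => WithLp.toLp 2 (Sum.elim (fun i => -w (Sum.inr i)) fun i => w (Sum.inl i))
      map_add' := fun w w' => by
        ext i; rcases i with i | i <;> simp [add_comm]
      map_smul' := fun c w => by
        ext i; rcases i with i | i <;> simp }

local notation "J₀" => complexStructure _

@[simp]
lemma complexStructure_inl (w : E n) (i : Fin n) : J₀ w (Sum.inl i) = -w (Sum.inr i) := rfl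

@[simp]
lemma complexStructure_inr (w : E n) (i : Fin n) : J₀ w (Sum.inr i) = w (Sum.inl i) := rfl

@[simp]
lemma complexStructure_complexStructure (w : E n) : J₀ (J₀ w) = -w := by
  ext i; rcases i with i | i <;> simp

lemma inner_eq_sum (w w' : E n) :
    inner ℝ w w' =
      ∑ i, (w (Sum.inl i) * w' (Sum.inl i) + w (Sum.inr i) * w' (Sum.inr i)) := by
  simp [PiLp.inner_apply, Fintype.sum_sum_type, Finset.sum_add_distrib, mul_comm]

lemma omega0_eq_inner (w w' : E n) : omega0 w w' = inner ℝ (J₀ w) w' := by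
  rw [inner_eq_sum, omega0]
  exact Finset.sum_congr rfl fun i _ => by simp; ring

@[simp]
lemma inner_complexStructure_complexStructure (w w' : E n) :
    inner ℝ (J₀ w) (J₀ w') = inner ℝ w w' := by
  simp only [inner_eq_sum, complexStructure_inl, complexStructure_inr]
  exact Finset.sum_congr rfl fun i _ => by ring

lemma inner_complexStructure_right (w w' : E n) :
    inner ℝ w (J₀ w') = -inner ℝ (J₀ w) w' := by
  rw [← inner_complexStructure_complexStructure w, complexStructure_complexStructure,
    inner_neg_right]

@[simp]
lemma inner_complexStructure_self (w : E n) : inner ℝ (J₀ w) w = 0 := by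
  have h := inner_complexStructure_right w w
  rw [real_inner_comm] at h
  linarith

/-- Rotation around `m` in the complex structure, by an angle `θ` depending on the squared
distance to `m`. -/
noncomputable def twistMap (m : E n) (θ : ℝ → ℝ) (z : E n) : E n :=
  m + (Real.cos (θ (‖z - m‖ ^ 2)) • (z - m) + Real.sin (θ (‖z - m‖ ^ 2)) • J₀ (z - m))

lemma norm_twistMap_sub (m : E n) (θ : ℝ → ℝ) (z : E n) : ‖twistMap m θ z - m‖ = ‖z - m‖ := by
  rw [← sq_eq_sq₀ (norm_nonneg _) (norm_nonneg _), ← real_inner_self_eq_norm_sq,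
    ← real_inner_self_eq_norm_sq]
  simp only [twistMap, add_sub_cancel_left, inner_add_left, inner_add_right, real_inner_smul_left,
    real_inner_smul_right, inner_complexStructure_self, inner_complexStructure_right,
    complexStructure_complexStructure, inner_neg_left]
  linear_combination (inner ℝ (z - m) (z - m)) * Real.sin_sq_add_cos_sq (θ (‖z - m‖ ^ 2))

lemma twistMap_neg_twistMap (m : E n) (θ : ℝ → ℝ) (z : E n) :
    twistMap m (-θ) (twistMap m θ z) = z := by
  rw [twistMap, norm_twistMap_sub]
  simp only [twistMap, add_sub_cancel_left, Pi.neg_apply, Real.cos_neg, Real.sin_neg, map_add,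
    map_smul, complexStructure_complexStructure]
  have h : (Real.cos (θ (‖z - m‖ ^ 2)) ^ 2 + Real.sin (θ (‖z - m‖ ^ 2)) ^ 2) • (z - m) = z - m := by
    rw [Real.cos_sq_add_sin_sq, one_smul]
  rw [← sub_eq_zero]
  rw [← sub_eq_zero] at h
  rw [← h]
  module

lemma contDiff_twistMap (m : E n) {θ : ℝ → ℝ} (hθ : ContDiff ℝ (⊤ : ℕ∞) θ) :
    ContDiff ℝ (⊤ : ℕ∞) (twistMap m θ) := by
  have h : ContDiff ℝ (⊤ : ℕ∞) fun z : E n => θ (‖z - m‖ ^ 2) :=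
    hθ.comp ((contDiff_id.sub contDiff_const).norm_sq ℝ)
  have hJ : ContDiff ℝ (⊤ : ℕ∞) fun z : E n => J₀ (z - m) :=
    (complexStructure n).contDiff.comp (contDiff_id.sub contDiff_const)
  exact contDiff_const.add ((h.cos.smul (contDiff_id.sub contDiff_const)).add (h.sin.smul hJ))

lemma fderiv_twistMap_apply (m : E n) {θ : ℝ → ℝ} (hθ : ContDiff ℝ (⊤ : ℕ∞) θ) (z w : E n) :
    fderiv ℝ (twistMap m θ) z w =
      Real.cos (θ (‖z - m‖ ^ 2)) • w + Real.sin (θ (‖z - m‖ ^ 2)) • J₀ w +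
        (2 * deriv θ (‖z - m‖ ^ 2) * inner ℝ (z - m) w) •
          (Real.cos (θ (‖z - m‖ ^ 2)) • J₀ (z - m) - Real.sin (θ (‖z - m‖ ^ 2)) • (z - m)) := by
  have hsub : HasFDerivAt (fun z : E n => z - m) (ContinuousLinearMap.id ℝ (E n)) z :=
    (hasFDerivAt_id z).sub_const m
  have hθ' : HasDerivAt θ (deriv θ (‖z - m‖ ^ 2)) (‖z - m‖ ^ 2) :=
    (hθ.differentiable (by simp)).differentiableAt.hasDerivAt
  have h := hθ'.comp_hasFDerivAt z hsub.norm_sq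
  have hJ : HasFDerivAt (fun z : E n => J₀ (z - m)) (complexStructure n) z := by
    exact (complexStructure n).hasFDerivAt.comp z hsub
  have hT := ((h.cos.smul hsub).add (h.sin.smul hJ)).const_add m
  have hT' : HasFDerivAt (twistMap m θ) _ z := hT
  rw [hT'.fderiv]
  simp only [Function.comp_apply, add_apply, smul_apply, ContinuousLinearMap.smulRight_apply,
    ContinuousLinearMap.comp_apply, ContinuousLinearMap.id_apply, innerSL_apply_apply,
    smul_eq_mul, nsmul_eq_mul, Nat.cast_ofNat]
  module

lemma omega0_fderiv_twistMap (m : E n) {θ : ℝ → ℝ} (hθ : ContDiff ℝ (⊤ : ℕ∞) θ) (z w w' : E n) :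
    omega0 (fderiv ℝ (twistMap m θ) z w) (fderiv ℝ (twistMap m θ) z w') = omega0 w w' := by
  rw [fderiv_twistMap_apply m hθ, fderiv_twistMap_apply m hθ]
  have h := Real.sin_sq_add_cos_sq (θ (‖z - m‖ ^ 2))
  generalize Real.cos (θ (‖z - m‖ ^ 2)) = c, Real.sin (θ (‖z - m‖ ^ 2)) = s,
    2 * deriv θ (‖z - m‖ ^ 2) = k at *
  generalize z - m = u
  simp only [omega0_eq_inner, map_add, map_smul, map_sub, complexStructure_complexStructure,
    inner_add_left, inner_add_right, inner_sub_left, inner_sub_right, real_inner_smul_left,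
    real_inner_smul_right, inner_complexStructure_self, inner_complexStructure_right,
    inner_neg_left]
  have h1 : inner ℝ (J₀ w) u = -inner ℝ (J₀ u) w := by
    rw [real_inner_comm, inner_complexStructure_right]
  rw [h1, real_inner_comm u w]
  linear_combination (inner ℝ (J₀ w) w') * h

/-- The twist map as a compactly supported symplectomorphism. -/
noncomputable def twist (m : E n) (θ : ℝ → ℝ) (hθ : ContDiff ℝ (⊤ : ℕ∞) θ) (r : ℝ)
    (hr : ∀ s, r ^ 2 ≤ s → θ s = 0) : CSSymplectomorphism n where
  toFun := twistMap m θ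
  invFun := twistMap m (-θ)
  left_inv := twistMap_neg_twistMap m θ
  right_inv z := by simpa using twistMap_neg_twistMap m (-θ) z
  smooth := contDiff_twistMap m hθ
  smooth_inv := contDiff_twistMap m hθ.neg
  compactSupp := by
    refine (isCompact_closedBall m |r|).of_isClosed_subset isClosed_closure
      (closure_minimal (fun z hz => ?_) isClosed_closedBall)
    by_contra hzr
    rw [mem_closedBall, dist_eq_norm, not_le] at hzr
    refine hz ?_
    have : r ^ 2 ≤ ‖z - m‖ ^ 2 := sq_le_sq.2 (by rw [abs_norm]; exact hzr.le)
    simp [twistMap, hr _ this]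
  symplectic := omega0_fderiv_twistMap m hθ

/-- Point reflections in a ball, extended by a twist to a compactly supported
symplectomorphism. -/
lemma exists_local_reflection (m : E n) {δ : ℝ} (hδ : 0 < δ) :
    ∃ φ ψ : CSSymplectomorphism n, φ.invFun = ψ.toFun ∧ ψ.invFun = φ.toFun ∧
      (∀ z, dist (φ.toFun z) m = dist z m) ∧
      (∀ z, dist z m ≤ 2 * δ → φ.toFun z = 2 • m - z) ∧
      ∀ z, 3 * δ ≤ dist z m → φ.toFun z = z := by
  let θ : ℝ → ℝ := fun s => Real.pi * Real.smoothTransition ((9 * δ ^ 2 - s) / (5 * δ ^ 2))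
  have hθ : ContDiff ℝ (⊤ : ℕ∞) θ :=
    contDiff_const.mul (Real.smoothTransition.contDiff.comp
      ((contDiff_const.sub contDiff_id).div_const _))
  have hr : ∀ s, (3 * δ) ^ 2 ≤ s → θ s = 0 := fun s hs => by
    have : (9 * δ ^ 2 - s) / (5 * δ ^ 2) ≤ 0 :=
      div_nonpos_of_nonpos_of_nonneg (by nlinarith) (by positivity)
    simp [θ, Real.smoothTransition.zero_of_nonpos this]
  refine ⟨twist m θ hθ (3 * δ) hr, twist m (-θ) hθ.neg (3 * δ) fun s hs => by simp [hr s hs],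
    rfl, by simp [twist], fun z => ?_, fun z hz => ?_, fun z hz => ?_⟩
  · rw [dist_eq_norm, dist_eq_norm]
    exact norm_twistMap_sub m θ z
  · rw [dist_eq_norm] at hz
    have : 1 ≤ (9 * δ ^ 2 - ‖z - m‖ ^ 2) / (5 * δ ^ 2) := by
      rw [le_div_iff₀ (by positivity)]
      nlinarith [norm_nonneg (z - m)]
    have : θ (‖z - m‖ ^ 2) = Real.pi := by simp [θ, Real.smoothTransition.one_of_one_le this]
    simp only [twist, twistMap, this, Real.cos_pi, Real.sin_pi]
    module
  · rw [dist_eq_norm] at hz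
    have : θ (‖z - m‖ ^ 2) = 0 := hr _ (by gcongr)
    simp [twist, twistMap, this]

lemma toMatrix_mem_symplecticGroup (A : E n →L[ℝ] E n)
    (hA : ∀ w w', omega0 (A w) (A w') = omega0 w w') :
    LinearMap.toMatrix (EuclideanSpace.basisFun (Fin n ⊕ Fin n) ℝ).toBasis
      (EuclideanSpace.basisFun (Fin n ⊕ Fin n) ℝ).toBasis A.toLinearMap ∈
      Matrix.symplecticGroup (Fin n) ℝ := by
  rw [SymplecticGroup.mem_iff']
  have hJ (i j : Fin n ⊕ Fin n) :
      omega0 (EuclideanSpace.single i (1 : ℝ)) (EuclideanSpace.single j 1) =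
        -Matrix.J (Fin n) ℝ i j := by
    rcases i with i | i <;> rcases j with j | j <;>
      simp [omega0, Matrix.J, Matrix.one_apply, eq_comm]
  ext i j
  rw [← neg_inj, ← hJ, ← hA]
  simp [Matrix.mul_apply, Matrix.J, Fintype.sum_sum_type, LinearMap.toMatrix_apply, omega0,
    Matrix.one_apply]
  rw [sub_eq_add_neg]

lemma measurePreserving (φ : CSSymplectomorphism n) :
    MeasurePreserving φ.toFun (volume : Measure (E n)) volume := by
  have hdet (z : E n) : (fderiv ℝ φ.toFun z).det = 1 := by
    rw [ContinuousLinearMap.det, ← LinearMap.det_toMatrix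
      (EuclideanSpace.basisFun (Fin n ⊕ Fin n) ℝ).toBasis]
    exact SymplecticGroup.det_eq_one
      (toMatrix_mem_symplecticGroup _ (φ.symplectic z))
  refine ⟨φ.smooth.continuous.measurable, ?_⟩
  have h := map_withDensity_abs_det_fderiv_eq_addHaar (volume : Measure (E n))
    MeasurableSet.univ.nullMeasurableSet
    (fun z _ => ((φ.smooth.differentiable (by simp)) z).hasFDerivAt.hasFDerivWithinAt)
    φ.left_inv.injective.injOn
  simpa [hdet, φ.right_inv.surjective.range_eq] using h

end CSSymplectomorphism

section ReflectionInvariance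

open Metric Filter Topology

variable {F : Type*} [NormedAddCommGroup F] [NormedSpace ℝ F]

lemma isPreconnected_compl_closedBall (hF : 1 < Module.rank ℝ F) (x : F) {r : ℝ} (hr : 0 ≤ r) :
    IsPreconnected (closedBall x r)ᶜ := by
  have himage : (fun z : F => x + (1 + r / ‖z‖) • z) '' {0}ᶜ = (closedBall x r)ᶜ := by
    ext w
    simp only [Set.mem_image, Set.mem_compl_iff, Set.mem_singleton_iff, mem_closedBall, not_le,
      dist_eq_norm]
    constructor
    · rintro ⟨z, hz, rfl⟩
      have hz' : 0 < ‖z‖ := norm_pos_iff.2 hz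
      rw [add_sub_cancel_left, norm_smul, Real.norm_of_nonneg (by positivity), add_mul,
        div_mul_cancel₀ _ hz'.ne']
      linarith
    · intro hw
      have hw' : 0 < ‖w - x‖ := hr.trans_lt hw
      have hs : 0 < 1 - r / ‖w - x‖ := by
        rw [sub_pos, div_lt_one hw']
        exact hw
      refine ⟨(1 - r / ‖w - x‖) • (w - x), smul_ne_zero hs.ne' (norm_pos_iff.1 hw'), ?_⟩
      rw [norm_smul, Real.norm_of_nonneg hs.le, smul_smul]
      have : (1 + r / ((1 - r / ‖w - x‖) * ‖w - x‖)) * (1 - r / ‖w - x‖) = 1 := by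
        have : ‖w - x‖ - r ≠ 0 := by linarith
        field_simp
        ring
      rw [this, one_smul, add_sub_cancel]
  rw [← himage]
  refine (isConnected_compl_singleton_of_one_lt_rank hF 0).isPreconnected.image _ ?_
  refine continuousOn_const.add (ContinuousOn.smul (continuousOn_const.add
    (continuousOn_const.div continuous_norm.continuousOn fun z hz => ?_)) continuousOn_id)
  simpa using hz

/-- A function is invariant in `U` under point reflections of balls that lie well inside `U`. -/
def IsReflectionInvariant [MeasurableSpace F] (μ : Measure F) (U : Set F) (f : F → ℂ) : Prop :=
  ∀ (m : F) (δ : ℝ), 0 < δ → closedBall m (3 * δ) ⊆ U →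
    ∀ᵐ z ∂μ, z ∈ closedBall m (2 * δ) → f (2 • m - z) = f z

variable [FiniteDimensional ℝ F] [MeasurableSpace F] [BorelSpace F] {μ : Measure F}
  [μ.IsAddHaarMeasure]

lemma ae_tendsto_average_closedBall {f : F → ℂ} (hf : LocallyIntegrable f μ) :
    ∀ᵐ x ∂μ, Tendsto (fun ε => ⨍ y in closedBall x ε, f y ∂μ) (𝓝[>] 0) (𝓝 (f x)) := by
  filter_upwards [IsUnifLocDoublingMeasure.ae_tendsto_average μ hf 1] with x hx
  refine hx (fun _ : ℝ => x) id tendsto_id ?_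
  filter_upwards [self_mem_nhdsWithin] with ε hε
  simpa using le_of_lt hε

lemma IsReflectionInvariant.setIntegral_eq {U : Set F} {f : F → ℂ}
    (h : IsReflectionInvariant μ U f) {x y : F} {δ : ℝ} (hδ : 0 < δ)
    (hU : closedBall x (4 * δ) ⊆ U) (hy : dist y x ≤ 2 * δ) {ε : ℝ} (hε : ε ≤ δ) :
    ∫ z in closedBall x ε, f z ∂μ = ∫ z in closedBall y ε, f z ∂μ := by
  have hm : dist x (midpoint ℝ x y) ≤ δ := by
    rw [dist_left_midpoint, dist_comm x y, Real.norm_of_nonneg zero_le_two]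
    linarith
  have h2m : (2 : ℕ) • midpoint ℝ x y = x + y := by
    rw [two_smul, midpoint_add_self]
  have hsub : closedBall (midpoint ℝ x y) (3 * δ) ⊆ U :=
    (closedBall_subset_closedBall' (by rw [dist_comm]; linarith)).trans hU
  have hae := h _ δ hδ hsub
  rw [h2m] at hae
  have hmp : MeasurePreserving (fun z => x + y - z) μ μ :=
    Measure.measurePreserving_sub_left μ (x + y)
  have hpre : (fun z => x + y - z) ⁻¹' closedBall y ε = closedBall x ε := by
    ext z
    simp only [Set.mem_preimage, mem_closedBall, dist_eq_norm]
    rw [show x + y - z - y = -(z - x) by abel, norm_neg]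
  rw [← hmp.setIntegral_preimage_emb (Homeomorph.subLeft (x + y)).measurableEmbedding f
    (closedBall y ε), hpre]
  refine setIntegral_congr_ae measurableSet_closedBall ?_
  filter_upwards [hae] with z hz hzx
  exact (hz (closedBall_subset_closedBall' (by linarith) hzx)).symm

lemma IsReflectionInvariant.ae_const {U : Set F} {f : F → ℂ}
    (h : IsReflectionInvariant μ U f) (hf : LocallyIntegrable f μ) (hU : IsOpen U)
    (hc : IsPreconnected U) : ∃ a, ∀ᵐ x ∂μ, x ∈ U → f x = a := by
  have key {x y : F} (hx : x ∈ U) (hy : y ∈ U) : ∀ᶠ ε in 𝓝[>] (0 : ℝ),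
      ∫ z in closedBall x ε, f z ∂μ = ∫ z in closedBall y ε, f z ∂μ := by
    refine hc.induction₂ (fun x y => ∀ᶠ ε in 𝓝[>] (0 : ℝ),
      ∫ z in closedBall x ε, f z ∂μ = ∫ z in closedBall y ε, f z ∂μ) (fun x hx => ?_)
      (fun x y z _ _ _ hxy hyz => ?_) (fun x y _ _ hxy => ?_) hx hy
    · obtain ⟨s, hs, hsU⟩ := nhds_basis_closedBall.mem_iff.1 (hU.mem_nhds hx)
      have hs4 : 0 < s / 4 := by positivity
      filter_upwards [mem_nhdsWithin_of_mem_nhds (closedBall_mem_nhds x (by positivity :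
        0 < 2 * (s / 4)))] with y hy
      filter_upwards [mem_nhdsWithin_of_mem_nhds (Iic_mem_nhds hs4)] with ε hε
      exact h.setIntegral_eq hs4 (by rwa [mul_div_cancel₀ s four_ne_zero]) hy hε
    · filter_upwards [hxy, hyz] with ε h1 h2 using h1.trans h2
    · filter_upwards [hxy] with ε h1 using h1.symm
  have hleb := ae_tendsto_average_closedBall hf
  by_cases hex : ∃ x ∈ U, Tendsto (fun ε => ⨍ y in closedBall x ε, f y ∂μ) (𝓝[>] 0) (𝓝 (f x))
  · obtain ⟨x, hx, hfx⟩ := hex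
    refine ⟨f x, ?_⟩
    filter_upwards [hleb] with y hfy hy
    refine tendsto_nhds_unique hfy (hfx.congr' ?_)
    filter_upwards [key hx hy] with ε hε
    rw [setAverage_eq, setAverage_eq, hε, measureReal_def, measureReal_def,
      Measure.addHaar_closedBall_center μ x, Measure.addHaar_closedBall_center μ y]
  · push Not at hex
    refine ⟨0, ?_⟩
    filter_upwards [hleb] with y hfy hy
    exact absurd hfy (hex y hy)

end ReflectionInvariance

section Projection

open Metric Filter Topology

variable {n : ℕ}

/-- The indicator function of a closed ball as an element of `L²`. -/
noncomputable def ballIndicator (x : E n) (r : ℝ) : Lp ℂ 2 (volume : Measure (E n)) :=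
  indicatorConstLp 2 measurableSet_closedBall (measure_closedBall_lt_top (x := x) (r := r)).ne 1

lemma inner_ballIndicator_left (x : E n) (r : ℝ) (f : Lp ℂ 2 (volume : Measure (E n))) :
    inner ℂ (ballIndicator x r) f = ∫ z in closedBall x r, f z :=
  L2.inner_indicatorConstLp_one _ _ f

lemma locallyIntegrable_coeFn (f : Lp ℂ 2 (volume : Measure (E n))) :
    LocallyIntegrable f volume :=
  (Lp.memLp f).locallyIntegrable (by norm_num)

lemma eq_zero_of_inner_ballIndicator_eq_zero (f : Lp ℂ 2 (volume : Measure (E n)))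
    (h : ∀ x r, 0 < r → inner ℂ (ballIndicator x r) f = 0) : f = 0 := by
  refine Lp.ext ((?_ : _ =ᵐ[volume] (0 : E n → ℂ)).trans (Lp.coeFn_zero _ _ _).symm)
  filter_upwards [ae_tendsto_average_closedBall (locallyIntegrable_coeFn f)] with x hx
  refine tendsto_nhds_unique hx (tendsto_const_nhds.congr' ?_)
  filter_upwards [self_mem_nhdsWithin] with ε hε
  rw [setAverage_eq, ← inner_ballIndicator_left, h x ε hε, smul_zero, Pi.zero_apply]

variable {H₀ : Submodule ℂ (Lp ℂ 2 (volume : Measure (E n)))} [H₀.HasOrthogonalProjection]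

lemma starProjection_compMeasurePreserving
    (hinv : ∀ φ : CSSymplectomorphism n, ∀ f ∈ H₀,
      ∀ g : Lp ℂ 2 (volume : Measure (E n)),
        (g : E n → ℂ) =ᵐ[volume] (fun p => f (φ.invFun p)) → g ∈ H₀)
    {φ ψ : CSSymplectomorphism n} (hφψ : φ.invFun = ψ.toFun) (hψφ : ψ.invFun = φ.toFun)
    (f : Lp ℂ 2 (volume : Measure (E n))) :
    H₀.starProjection (Lp.compMeasurePreserving φ.toFun φ.measurePreserving f) =
      Lp.compMeasurePreserving φ.toFun φ.measurePreserving (H₀.starProjection f) := by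
  have hφ {g} (hg : g ∈ H₀) : Lp.compMeasurePreserving φ.toFun φ.measurePreserving g ∈ H₀ :=
    hinv ψ g hg _ (by
      rw [hψφ]
      exact Lp.coeFn_compMeasurePreserving g φ.measurePreserving)
  have hψ {g} (hg : g ∈ H₀) : Lp.compMeasurePreserving ψ.toFun ψ.measurePreserving g ∈ H₀ :=
    hinv φ g hg _ (by
      rw [hφψ]
      exact Lp.coeFn_compMeasurePreserving g ψ.measurePreserving)
  refine Submodule.eq_starProjection_of_mem_of_inner_eq_zero
    (hφ (H₀.starProjection_apply_mem f)) fun w hw => ?_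
  have hw' : w = Lp.compMeasurePreserving φ.toFun φ.measurePreserving
      (Lp.compMeasurePreserving ψ.toFun ψ.measurePreserving w) := by
    rw [← Lp.compMeasurePreserving_comp_apply]
    have hid : ψ.toFun ∘ φ.toFun = id := by
      rw [← hφψ]
      exact φ.left_inv.id
    simp only [hid, Lp.compMeasurePreserving_id_apply]
  rw [hw', ← map_sub]
  exact ((Lp.compMeasurePreservingₗᵢ ℂ φ.toFun φ.measurePreserving).inner_map_map _ _).trans
    (H₀.starProjection_inner_eq_zero f _ (hψ hw))

lemma isReflectionInvariant_starProjection
    (hinv : ∀ φ : CSSymplectomorphism n, ∀ f ∈ H₀,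
      ∀ g : Lp ℂ 2 (volume : Measure (E n)),
        (g : E n → ℂ) =ᵐ[volume] (fun p => f (φ.invFun p)) → g ∈ H₀)
    {x : E n} {r : ℝ} {U : Set (E n)} (hU : U ⊆ closedBall x r ∨ U ⊆ (closedBall x r)ᶜ) :
    IsReflectionInvariant volume U (H₀.starProjection (ballIndicator x r)) := by
  intro m δ hδ hmU
  obtain ⟨φ, ψ, hφψ, hψφ, hdist, hrefl, hfix⟩ :=
    CSSymplectomorphism.exists_local_reflection m hδ
  have hpre : φ.toFun ⁻¹' closedBall x r = closedBall x r := by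
    ext z
    rw [Set.mem_preimage]
    by_cases hz : dist z m ≤ 3 * δ
    · have h1 : z ∈ U := hmU hz
      have h2 : φ.toFun z ∈ U := hmU (by rwa [mem_closedBall, hdist])
      rcases hU with hU | hU
      · exact iff_of_true (hU h2) (hU h1)
      · exact iff_of_false (hU h2) (hU h1)
    · rw [hfix z (not_le.1 hz).le]
  have hinvar : Lp.compMeasurePreserving φ.toFun φ.measurePreserving (ballIndicator x r) =
      ballIndicator x r := by
    rw [ballIndicator, Lp.indicatorConstLp_compMeasurePreserving]
    congr
  have h := starProjection_compMeasurePreserving hinv hφψ hψφ (ballIndicator x r)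
  rw [hinvar] at h
  have hae := Lp.coeFn_compMeasurePreserving (H₀.starProjection (ballIndicator x r))
    φ.measurePreserving
  rw [← h] at hae
  filter_upwards [hae] with z hz hzm
  rw [hz, Function.comp_apply, hrefl z hzm]

lemma exists_starProjection_ballIndicator_eq_smul (hn : 1 ≤ n)
    (hinv : ∀ φ : CSSymplectomorphism n, ∀ f ∈ H₀,
      ∀ g : Lp ℂ 2 (volume : Measure (E n)),
        (g : E n → ℂ) =ᵐ[volume] (fun p => f (φ.invFun p)) → g ∈ H₀)
    (x : E n) {r : ℝ} (hr : 0 < r) :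
    ∃ c : ℂ, H₀.starProjection (ballIndicator x r) = c • ballIndicator x r := by
  have : Nonempty (Fin n) := ⟨⟨0, hn⟩⟩
  have hrank : 1 < Module.rank ℝ (E n) := by
    rw [← Module.finrank_eq_rank, finrank_euclideanSpace, Fintype.card_sum, Fintype.card_fin]
    exact_mod_cast (by lia : 1 < n + n)
  set g := H₀.starProjection (ballIndicator x r)
  have hloc := locallyIntegrable_coeFn g
  obtain ⟨c, hc⟩ := (isReflectionInvariant_starProjection hinv
    (Or.inl ball_subset_closedBall)).ae_const hloc isOpen_ball (convex_ball x r).isPreconnected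
  obtain ⟨a, ha⟩ := (isReflectionInvariant_starProjection hinv
    (Or.inr subset_rfl)).ae_const hloc isClosed_closedBall.isOpen_compl
    (isPreconnected_compl_closedBall hrank x hr.le)
  have ha0 : a = 0 := by
    have hmem : MemLp (fun _ => a) 2 (volume.restrict (closedBall x r)ᶜ) :=
      ((Lp.memLp g).restrict _).ae_eq
        ((ae_restrict_iff' measurableSet_closedBall.compl).2 ha)
    rw [memLp_const_iff two_ne_zero ENNReal.ofNat_ne_top, Measure.restrict_apply_univ] at hmem
    refine hmem.resolve_right fun hlt => ?_
    have := measure_add_measure_compl (μ := (volume : Measure (E n)))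
      (measurableSet_closedBall (x := x) (ε := r))
    rw [measure_univ_of_isAddLeftInvariant] at this
    exact (ENNReal.add_lt_top.2 ⟨measure_closedBall_lt_top, hlt⟩).ne this
  refine ⟨c, Lp.ext ?_⟩
  have hsphere : ∀ᵐ z ∂(volume : Measure (E n)), z ∉ sphere x r :=
    measure_eq_zero_iff_ae_notMem.1 (Measure.addHaar_sphere volume x r)
  filter_upwards [hc, ha, hsphere, Lp.coeFn_smul c (ballIndicator x r),
    indicatorConstLp_coeFn (p := 2) (hs := measurableSet_closedBall)
      (hμs := (measure_closedBall_lt_top (x := x) (r := r)).ne) (c := (1 : ℂ))]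
    with z hzc hza hzs hz1 hz2
  rw [hz1, Pi.smul_apply, ballIndicator, hz2]
  by_cases hz : z ∈ closedBall x r
  · rw [Set.indicator_of_mem hz, smul_eq_mul, mul_one]
    exact hzc (lt_of_le_of_ne hz hzs)
  · rw [Set.indicator_of_notMem hz, smul_zero, hza hz, ha0]

lemma inner_ballIndicator_of_subset {x y : E n} {r s : ℝ}
    (h : closedBall x r ⊆ closedBall y s) :
    inner ℂ (ballIndicator x r) (ballIndicator y s) =
      ((volume : Measure (E n)).real (closedBall x r) : ℂ) := by
  rw [ballIndicator, ballIndicator, L2.inner_indicatorConstLp_indicatorConstLp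
    (hμs := measure_closedBall_lt_top.ne) (hμt := measure_closedBall_lt_top.ne)]
  simp [Set.inter_eq_left.2 h]

lemma exists_starProjection_eq_smul (hn : 1 ≤ n)
    (hinv : ∀ φ : CSSymplectomorphism n, ∀ f ∈ H₀,
      ∀ g : Lp ℂ 2 (volume : Measure (E n)),
        (g : E n → ℂ) =ᵐ[volume] (fun p => f (φ.invFun p)) → g ∈ H₀) :
    ∃ c : ℂ, ∀ f, H₀.starProjection f = c • f := by
  choose! c hc using fun (x : E n) (r : ℝ) =>
    exists_starProjection_ballIndicator_eq_smul (H₀ := H₀) hn hinv x (r := r)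
  have hconj {x y : E n} {r s : ℝ} (hr : 0 < r) (hs : 0 < s)
      (h : closedBall x r ⊆ closedBall y s) : star (c x r) = c y s := by
    have hsymm := H₀.inner_starProjection_left_eq_right (ballIndicator x r) (ballIndicator y s)
    rw [hc x r hr, hc y s hs, inner_smul_left, inner_smul_right,
      inner_ballIndicator_of_subset h] at hsymm
    refine mul_right_cancel₀ ?_ hsymm
    have hpos : 0 < (volume : Measure (E n)).real (closedBall x r) :=
      ENNReal.toReal_pos (measure_closedBall_pos _ _ hr).ne' measure_closedBall_lt_top.ne
    exact_mod_cast hpos.ne'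
  have hconst (x : E n) {r : ℝ} (hr : 0 < r) : star (c x r) = star (c 0 1) := by
    have hs : 0 < r + dist x 0 + 1 := by positivity
    rw [hconj hr hs (closedBall_subset_closedBall' (y := 0) (by linarith)),
      hconj one_pos hs (closedBall_subset_closedBall
        (by linarith [dist_nonneg (x := x) (y := 0)]))]
  refine ⟨star (c 0 1), fun f => ?_⟩
  rw [← sub_eq_zero]
  refine eq_zero_of_inner_ballIndicator_eq_zero _ fun x r hr => ?_
  rw [inner_sub_right, ← H₀.inner_starProjection_left_eq_right, hc x r hr, inner_smul_left,
    inner_smul_right, ← hconst x hr, sub_eq_zero]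
  rfl

end Projection

/-- Irreducibility of the representation `Π(φ)f = f ∘ φ⁻¹` of the group of
compactly supported symplectomorphisms of `ℝ²ⁿ` on `L²(ℝ²ⁿ, λ)`: every invariant
closed subspace is trivial. -/
theorem symplectomorphism_representation_irreducible
    (n : ℕ) (hn : 1 ≤ n)
    (H₀ : Submodule ℂ (Lp ℂ 2 (volume : Measure (E n))))
    (hclosed : IsClosed (H₀ : Set (Lp ℂ 2 (volume : Measure (E n)))))
    (hinv : ∀ φ : CSSymplectomorphism n, ∀ f ∈ H₀,
      ∀ g : Lp ℂ 2 (volume : Measure (E n)),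
        (g : E n → ℂ) =ᵐ[volume] (fun p => f (φ.invFun p)) → g ∈ H₀) :
    H₀ = ⊥ ∨ H₀ = ⊤ := by
  have : CompleteSpace H₀ := hclosed.completeSpace_coe
  obtain ⟨c, hc⟩ := exists_starProjection_eq_smul hn hinv
  by_cases h0 : c = 0
  · refine Or.inl ((Submodule.eq_bot_iff _).2 fun f hf => ?_)
    rw [← Submodule.starProjection_eq_self_iff.2 hf, hc, h0, zero_smul]
  · refine Or.inr (Submodule.eq_top_iff'.2 fun f => ?_)
    rw [← H₀.smul_mem_iff h0, ← hc]
    exact H₀.starProjection_apply_mem f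
end

section
/- Let n ≥ 1, let x ∈ ℝ^{2n+1}, and let r > 0. Then there exists a compactly supported contactomorphism ρ of (ℝ^{2n+1}, ker α₀) such that ρ(y) = y · x for all y in the open ball of radius r centered at 0, where y · x denotes the Heisenberg group product. -/
open MeasureTheory

/-- `ℝ²ⁿ⁺¹ = ℝⁿ × ℝⁿ × ℝ`, identified with the Heisenberg group `H_n`. -/
abbrev H (n : ℕ) := EuclideanSpace ℝ (Fin n) × EuclideanSpace ℝ (Fin n) × ℝ

/-- The Heisenberg group product `(x,y,z)·(x',y',z') = (x+x', y+y', z+z'+⟨x,y'⟩)`. -/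
noncomputable def hmul {n : ℕ} (p q : H n) : H n :=
  (p.1 + q.1, p.2.1 + q.2.1, p.2.2 + q.2.2 + ∑ i, p.1 i * q.2.1 i)

/-- The standard contact form `α₀ = dz - ∑ yⁱ dxⁱ`: at the point `p = (x,y,z)`,
applied to a tangent vector `ζ = (u,v,w)` it gives `w - ⟨y,u⟩`. -/
noncomputable def alpha0 {n : ℕ} (p : H n) (ζ : H n) : ℝ :=
  ζ.2.2 - ∑ i, p.2.1 i * ζ.1 i

/-- A compactly supported contactomorphism of `(ℝ²ⁿ⁺¹, ker α₀)`: a `C^∞`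
diffeomorphism whose support has compact closure and whose derivative preserves
the contact distribution `ker α₀`. -/
structure CSContactomorphism (n : ℕ) where
  toFun : H n → H n
  invFun : H n → H n
  left_inv : Function.LeftInverse invFun toFun
  right_inv : Function.RightInverse invFun toFun
  smooth : ContDiff ℝ (⊤ : ℕ∞) toFun
  smooth_inv : ContDiff ℝ (⊤ : ℕ∞) invFun
  compactSupp : IsCompact (closure {p | toFun p ≠ p})
  contact : ∀ p ζ, alpha0 p ζ = 0 → alpha0 (toFun p) (fderiv ℝ toFun p ζ) = 0

open Topology Filter
open scoped InnerProductSpace ContDiff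

/-- A perturbation of the identity by a smooth map whose derivative has norm at most `1/2` is a
diffeomorphism. -/
theorem exists_equiv_add_of_norm_fderiv_le {E : Type*} [NormedAddCommGroup E] [NormedSpace ℝ E]
    [CompleteSpace E] {u : E → E} (hu : ContDiff ℝ ∞ u) (hu' : ∀ p, ‖fderiv ℝ u p‖ ≤ 1 / 2) :
    ∃ e : E ≃ E, (∀ p, e p = p + u p) ∧ ContDiff ℝ ∞ e.symm := by
  have hdiff : Differentiable ℝ u := hu.differentiable (by simp)
  have hlip : LipschitzWith (1 / 2) u :=
    lipschitzWith_of_nnnorm_fderiv_le hdiff fun p => by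
      rw [← NNReal.coe_le_coe]; simpa using hu' p
  have happ : ApproximatesLinearOn (fun p => p + u p)
      ((ContinuousLinearEquiv.refl ℝ E : E ≃L[ℝ] E) : E →L[ℝ] E) Set.univ (1 / 2) := by
    intro p _ q _
    have h := hlip.norm_sub_le p q
    have h' : p + u p - (q + u q) - (p - q) = u p - u q := by abel
    simpa [h'] using h
  have hc : Subsingleton E ∨ (1 / 2 : NNReal) <
      ‖((ContinuousLinearEquiv.refl ℝ E).symm : E →L[ℝ] E)‖₊⁻¹ := by
    rcases subsingleton_or_nontrivial E with h | h
    · exact Or.inl h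
    · right
      have : ‖((ContinuousLinearEquiv.refl ℝ E).symm : E →L[ℝ] E)‖₊ = 1 :=
        nnnorm_one (G := E →L[ℝ] E)
      rw [this, ← NNReal.coe_lt_coe]
      norm_num
  let e := happ.toHomeomorph _ hc
  have hderiv (p : E) : ∃ L : E ≃L[ℝ] E, HasFDerivAt e (L : E →L[ℝ] E) p := by
    have hlt : ‖-fderiv ℝ u p‖ < 1 := by
      rw [norm_neg]; linarith [hu' p]
    refine ⟨ContinuousLinearEquiv.ofUnit (Units.oneSub _ hlt), ?_⟩
    refine ((hasFDerivAt_id p).add (hdiff p).hasFDerivAt).congr_fderiv ?_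
    ext v
    change v + fderiv ℝ u p v = (1 - -fderiv ℝ u p) v
    simp
  choose L hL using hderiv
  exact ⟨e.toEquiv, fun p => rfl, e.contDiff_symm hL (contDiff_id.add hu)⟩

/-- In a family of maps supported in a fixed compact set, smooth near time `0` and vanishing at time
`0`, the derivatives are uniformly small for small times. -/
theorem eventually_norm_fderiv_le {E F : Type*} [NormedAddCommGroup E] [NormedSpace ℝ E]
    [NormedAddCommGroup F] [NormedSpace ℝ F] {u : ℝ → E → F} {K : Set E} (hK : IsCompact K)
    (hu : ∀ p, ContDiffAt ℝ 1 (Function.uncurry u) (0, p)) (h0 : ∀ p, u 0 p = 0)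
    (hsupp : ∀ t, ∀ p ∉ K, u t p = 0) {ε : ℝ} (hε : 0 < ε) :
    ∀ᶠ t in 𝓝 0, ∀ p, ‖fderiv ℝ (u t) p‖ ≤ ε := by
  have key : ∀ᶠ t in 𝓝 (0 : ℝ), ∀ p ∈ K, ‖fderiv ℝ (u t) p‖ < ε := by
    refine hK.eventually_forall_of_forall_eventually fun p _ => ?_
    have hc : ContinuousAt (fun z : ℝ × E => fderiv ℝ (u z.1) z.2) (0, p) := by
      refine ContDiffAt.continuousAt (𝕜 := ℝ) (n := 0)
        (ContDiffAt.fderiv (f := fun z : ℝ × E => u z.1) (n := 1) ?_ contDiffAt_snd (by simp))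
      exact ContDiffAt.comp ((0, p), p) (f := fun w : (ℝ × E) × E => (w.1.1, w.2))
        (g := Function.uncurry u) (hu p) (by fun_prop)
    have h00 : fderiv ℝ (u 0) p = 0 := by
      rw [show u 0 = fun _ => 0 from funext h0]; simp
    have := hc.norm.eventually_lt (continuousAt_const (y := ε)) (by simpa [h00] using hε)
    exact this
  filter_upwards [key] with t ht p
  by_cases hp : p ∈ K
  · exact (ht p hp).le
  · have hloc : u t =ᶠ[𝓝 p] fun _ => 0 :=
      Filter.eventually_of_mem (hK.isClosed.isOpen_compl.mem_nhds hp) (hsupp t)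
    rw [hloc.fderiv_eq]
    simpa using hε.le

section GeneratingFunction

variable {n : ℕ}

/-- The partial gradient of `f` in the first `ℝⁿ` factor. -/
noncomputable def gradX (f : H n → ℝ) (p : H n) : EuclideanSpace ℝ (Fin n) :=
  WithLp.toLp 2 fun i => fderiv ℝ f p (EuclideanSpace.single i 1, 0, 0)

/-- The partial gradient of `f` in the second `ℝⁿ` factor. -/
noncomputable def gradY (f : H n → ℝ) (p : H n) : EuclideanSpace ℝ (Fin n) :=
  WithLp.toLp 2 fun i => fderiv ℝ f p (0, EuclideanSpace.single i 1, 0)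

/-- The partial derivative of `f` in the `ℝ` factor. -/
noncomputable def partialZ (f : H n → ℝ) (p : H n) : ℝ := fderiv ℝ f p (0, 0, 1)

/-- The displacement from `(x, Y, z)` to `(x, y, z)`, where `(1 + ∂f/∂z) y = Y - ∂f/∂x`. -/
noncomputable def sourceShift (f : H n → ℝ) (p : H n) : H n :=
  (0, -((1 + partialZ f p)⁻¹ • (gradX f p + partialZ f p • p.2.1)), 0)

/-- The displacement from `(x, Y, z)` to `(X, Y, Z)`, where `X = x - ∂f/∂Y` and
`Z = z + f - ⟨Y, ∂f/∂Y⟩`. -/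
noncomputable def targetShift (f : H n → ℝ) (p : H n) : H n :=
  (-gradY f p, 0, f p - ⟪p.2.1, gradY f p⟫_ℝ)

theorem sum_mul_eq_inner (v w : EuclideanSpace ℝ (Fin n)) : ∑ i, v i * w i = ⟪v, w⟫_ℝ := by
  simp [PiLp.inner_apply, mul_comm]

theorem alpha0_eq (p ζ : H n) : alpha0 p ζ = ζ.2.2 - ⟪p.2.1, ζ.1⟫_ℝ := by
  rw [alpha0, sum_mul_eq_inner]

theorem inner_toLp_single (L : EuclideanSpace ℝ (Fin n) →L[ℝ] ℝ) (v : EuclideanSpace ℝ (Fin n)) :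
    ⟪WithLp.toLp 2 fun i => L (EuclideanSpace.single i 1), v⟫_ℝ = L v := by
  conv_rhs => rw [← (EuclideanSpace.basisFun (Fin n) ℝ).sum_repr v, map_sum]
  rw [← sum_mul_eq_inner]
  simp [mul_comm]

theorem fderiv_apply_eq (f : H n → ℝ) (p ζ : H n) :
    fderiv ℝ f p ζ = ⟪gradX f p, ζ.1⟫_ℝ + ⟪gradY f p, ζ.2.1⟫_ℝ + partialZ f p * ζ.2.2 := by
  have hX := inner_toLp_single ((fderiv ℝ f p).comp (ContinuousLinearMap.inl ℝ _ _)) ζ.1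
  have hY := inner_toLp_single ((fderiv ℝ f p).comp
    ((ContinuousLinearMap.inr ℝ (EuclideanSpace ℝ (Fin n)) _).comp
      (ContinuousLinearMap.inl ℝ _ ℝ))) ζ.2.1
  have hZ : partialZ f p * ζ.2.2 = fderiv ℝ f p (0, 0, ζ.2.2) := by
    rw [show ((0, 0, ζ.2.2) : H n) = ζ.2.2 • (0, 0, 1) by simp, map_smul, partialZ, smul_eq_mul,
      mul_comm]
  have hζ : ζ = (ζ.1, 0) + (0, ζ.2.1, 0) + (0, 0, ζ.2.2) := by simp
  conv_lhs => rw [hζ, map_add, map_add]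
  rw [hZ]
  simp only [ContinuousLinearMap.comp_apply, ContinuousLinearMap.inl_apply,
    ContinuousLinearMap.inr_apply] at hX hY
  rw [← hX, ← hY]
  rfl

theorem one_add_partialZ_smul_sourceShift {f : H n → ℝ} {p : H n} (h : 1 + partialZ f p ≠ 0) :
    (1 + partialZ f p) • (p + sourceShift f p).2.1 = p.2.1 - gradX f p := by
  simp only [sourceShift, Prod.snd_add, Prod.fst_add, smul_add, smul_neg, smul_inv_smul₀ h,
    add_smul, one_smul]
  abel

/-- The maps `(x, Y, z) ↦ (x, y, z)` and `(x, Y, z) ↦ (X, Y, Z)` pull the contact form back to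
proportional forms. -/
theorem alpha0_targetShift {f : H n → ℝ} (hf : ContDiff ℝ ∞ f) {p : H n}
    (hz : 1 + partialZ f p ≠ 0) (hg : DifferentiableAt ℝ (gradY f) p)
    (hA : DifferentiableAt ℝ (sourceShift f) p) (η : H n) :
    alpha0 (p + targetShift f p) (fderiv ℝ (fun q => q + targetShift f q) p η) =
      (1 + partialZ f p) *
        alpha0 (p + sourceShift f p) (fderiv ℝ (fun q => q + sourceShift f q) p η) := by
  have hY : HasFDerivAt (fun q : H n => q.2.1)
      ((ContinuousLinearMap.fst ℝ (EuclideanSpace ℝ (Fin n)) ℝ).comp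
        (ContinuousLinearMap.snd ℝ (EuclideanSpace ℝ (Fin n)) _)) p :=
    (hasFDerivAt_snd (p := p)).fst
  have hfd := (hf.differentiable (by simp) p).hasFDerivAt
  have hB : HasFDerivAt (fun q => q + targetShift f q) _ p :=
    (hasFDerivAt_id p).add (hg.hasFDerivAt.neg.prodMk
      ((hasFDerivAt_const (0 : EuclideanSpace ℝ (Fin n)) p).prodMk
        (hfd.sub (hY.inner ℝ hg.hasFDerivAt))))
  have hA' : HasFDerivAt (fun q => q + sourceShift f q)
      (fderiv ℝ (fun q => q + sourceShift f q) p) p := (differentiableAt_id.add hA).hasFDerivAt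
  have hA1 : (fderiv ℝ (fun q => q + sourceShift f q) p η).1 = η.1 := by
    have h := (hasFDerivAt_fst (p := p)).unique (hA'.fst.congr_of_eventuallyEq
      (Eventually.of_forall fun q => by simp [sourceShift]))
    exact (DFunLike.congr_fun h η).symm
  have hA2 : (fderiv ℝ (fun q => q + sourceShift f q) p η).2.2 = η.2.2 := by
    have h := (hasFDerivAt_snd (p := p)).snd.unique (hA'.snd.snd.congr_of_eventuallyEq
      (Eventually.of_forall fun q => by simp [sourceShift]))
    exact (DFunLike.congr_fun h η).symm
  have hs : (1 + partialZ f p) * ⟪(p + sourceShift f p).2.1, η.1⟫_ℝ =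
      ⟪p.2.1, η.1⟫_ℝ - ⟪gradX f p, η.1⟫_ℝ := by
    rw [← inner_sub_left, ← one_add_partialZ_smul_sourceShift hz, real_inner_smul_left]
  rw [alpha0_eq, alpha0_eq, hA1, hA2, mul_sub, hs, hB.fderiv]
  simp only [targetShift, _root_.add_apply, ContinuousLinearMap.prod_apply,
    _root_.sub_apply, _root_.neg_apply, ContinuousLinearMap.comp_apply,
    fderivInnerCLM_apply, Prod.snd_add, Prod.fst_add, _root_.zero_apply,
    ContinuousLinearMap.id_apply, fderiv_apply_eq f p η, inner_add_right, inner_neg_right, add_zero,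
    ContinuousLinearMap.coe_fst', ContinuousLinearMap.coe_snd']
  rw [real_inner_comm (gradY f p) η.2.1]
  ring

section Smoothness

variable {f : ℝ → H n → ℝ}

theorem contDiff_fderiv_family (hf : ContDiff ℝ ∞ (Function.uncurry f)) :
    ContDiff ℝ ∞ fun q : ℝ × H n => fderiv ℝ (f q.1) q.2 := by
  refine ContDiff.fderiv (f := fun q : ℝ × H n => f q.1) (m := ∞) ?_ contDiff_snd (by simp)
  exact hf.comp (f := fun w : (ℝ × H n) × H n => (w.1.1, w.2)) (by fun_prop)

theorem contDiff_gradX_family (hf : ContDiff ℝ ∞ (Function.uncurry f)) :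
    ContDiff ℝ ∞ fun q : ℝ × H n => gradX (f q.1) q.2 :=
  contDiff_euclidean.2 fun _ => (contDiff_fderiv_family hf).clm_apply contDiff_const

theorem contDiff_gradY_family (hf : ContDiff ℝ ∞ (Function.uncurry f)) :
    ContDiff ℝ ∞ fun q : ℝ × H n => gradY (f q.1) q.2 :=
  contDiff_euclidean.2 fun _ => (contDiff_fderiv_family hf).clm_apply contDiff_const

theorem contDiff_partialZ_family (hf : ContDiff ℝ ∞ (Function.uncurry f)) :
    ContDiff ℝ ∞ fun q : ℝ × H n => partialZ (f q.1) q.2 :=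
  (contDiff_fderiv_family hf).clm_apply contDiff_const

theorem contDiff_targetShift_family (hf : ContDiff ℝ ∞ (Function.uncurry f)) :
    ContDiff ℝ ∞ fun q : ℝ × H n => targetShift (f q.1) q.2 := by
  have hY := contDiff_gradY_family hf
  have h2 : ContDiff ℝ ∞ fun q : ℝ × H n => q.2.2.1 := by fun_prop
  exact hY.neg.prodMk (contDiff_const.prodMk (hf.sub (h2.inner ℝ hY)))

theorem contDiffAt_sourceShift_family (hf : ContDiff ℝ ∞ (Function.uncurry f))
    {q : ℝ × H n} (hz : 1 + partialZ (f q.1) q.2 ≠ 0) :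
    ContDiffAt ℝ ∞ (fun q : ℝ × H n => sourceShift (f q.1) q.2) q := by
  have hX := (contDiff_gradX_family hf).contDiffAt (x := q)
  have hZ := (contDiff_partialZ_family hf).contDiffAt (x := q)
  have h2 : ContDiffAt ℝ ∞ (fun q : ℝ × H n => q.2.2.1) q := by fun_prop
  exact contDiffAt_const.prodMk
    ((((contDiffAt_const.add hZ).inv hz).smul (hX.add (hZ.smul h2))).neg.prodMk contDiffAt_const)

end Smoothness

theorem contDiff_targetShift {f : H n → ℝ} (hf : ContDiff ℝ ∞ f) :
    ContDiff ℝ ∞ (targetShift f) :=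
  (contDiff_targetShift_family (f := fun _ => f) (hf.comp contDiff_snd)).comp
    (contDiff_prodMk_right (0 : ℝ))

theorem contDiff_gradY {f : H n → ℝ} (hf : ContDiff ℝ ∞ f) : ContDiff ℝ ∞ (gradY f) :=
  (contDiff_gradY_family (f := fun _ => f) (hf.comp contDiff_snd)).comp
    (contDiff_prodMk_right (0 : ℝ))

theorem contDiff_sourceShift {f : H n → ℝ} (hf : ContDiff ℝ ∞ f)
    (hz : ∀ p, 1 + partialZ f p ≠ 0) : ContDiff ℝ ∞ (sourceShift f) :=
  contDiff_iff_contDiffAt.2 fun p =>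
    ContDiffAt.comp p (f := fun p => ((0 : ℝ), p))
      (contDiffAt_sourceShift_family (f := fun _ => f) (hf.comp contDiff_snd) (hz p))
      (contDiff_prodMk_right (0 : ℝ)).contDiffAt

theorem sourceShift_eq_zero {f : H n → ℝ} {p : H n} (h : fderiv ℝ f p = 0) :
    sourceShift f p = 0 := by
  have hX : gradX f p = 0 := by ext i; simp [gradX, h]
  simp [sourceShift, partialZ, h, hX]

theorem targetShift_eq_zero {f : H n → ℝ} {p : H n} (h0 : f p = 0) (h : fderiv ℝ f p = 0) :
    targetShift f p = 0 := by
  have hY : gradY f p = 0 := by ext i; simp [gradY, h]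
  simp [targetShift, h0, hY]

/-- A sufficiently small compactly supported function generates a compactly supported
contactomorphism, sending `(x, y, z)` to `(X, Y, Z)`. -/
theorem exists_csContactomorphism_of_generating {f : H n → ℝ} (hf : ContDiff ℝ ∞ f)
    (hK : HasCompactSupport f) (hz : ∀ p, 1 + partialZ f p ≠ 0)
    (hA : ∀ p, ‖fderiv ℝ (sourceShift f) p‖ ≤ 1 / 2)
    (hB : ∀ p, ‖fderiv ℝ (targetShift f) p‖ ≤ 1 / 2) :
    ∃ ρ : CSContactomorphism n, ∀ q, ρ.toFun (q + sourceShift f q) = q + targetShift f q := by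
  have hAs := contDiff_sourceShift hf hz
  have hBs := contDiff_targetShift hf
  obtain ⟨a, ha, ha'⟩ := exists_equiv_add_of_norm_fderiv_le hAs hA
  obtain ⟨b, hb, hb'⟩ := exists_equiv_add_of_norm_fderiv_le hBs hB
  have haf : (a : H n → H n) = fun q => q + sourceShift f q := funext ha
  have hbf : (b : H n → H n) = fun q => q + targetShift f q := funext hb
  have has : ContDiff ℝ ∞ a := haf ▸ contDiff_id.add hAs
  have hbs : ContDiff ℝ ∞ b := hbf ▸ contDiff_id.add hBs
  refine ⟨⟨fun p => b (a.symm p), fun p => a (b.symm p), fun p => by simp, fun p => by simp,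
    hbs.comp ha', has.comp hb', ?_, ?_⟩, fun q => ?_⟩
  · refine hK.of_isClosed_subset isClosed_closure (closure_minimal (fun p hp => ?_)
      (isClosed_tsupport f))
    by_contra hpK
    have hd := fderiv_of_notMem_tsupport ℝ hpK
    have hap : a.symm p = p := by
      rw [Equiv.symm_apply_eq, ha, sourceShift_eq_zero hd, add_zero]
    refine hp ?_
    rw [hap, hb, targetShift_eq_zero (image_eq_zero_of_notMem_tsupport hpK) hd, add_zero]
  · intro p ζ hζ
    have hap : DifferentiableAt ℝ a (a.symm p) := has.differentiable (by simp) _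
    have hap' : DifferentiableAt ℝ a.symm p := ha'.differentiable (by simp) _
    have hid : fderiv ℝ a (a.symm p) (fderiv ℝ a.symm p ζ) = ζ := by
      rw [← ContinuousLinearMap.comp_apply, ← fderiv_comp p hap hap',
        show (a ∘ a.symm : H n → H n) = id from funext a.apply_symm_apply]
      simp
    have h := alpha0_targetShift hf (hz (a.symm p))
      ((contDiff_gradY hf).differentiable (by simp) _) (hAs.differentiable (by simp) _)
      (fderiv ℝ a.symm p ζ)
    rw [← ha, ← hb, ← haf, ← hbf, hid, a.apply_symm_apply, hζ, mul_zero] at h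
    have hc := fderiv_comp p (hbs.differentiable (by simp) (a.symm p)) hap'
    rw [show (fun p => b (a.symm p)) = b ∘ a.symm from rfl, hc]
    exact h
  · change b (a.symm _) = _
    rw [← ha, a.symm_apply_apply, hb]

/-- The generators of a family of functions with support in a fixed compact set, vanishing at time
`0`, give contactomorphisms for all small times. -/
theorem eventually_exists_csContactomorphism {f : ℝ → H n → ℝ}
    (hf : ContDiff ℝ ∞ (Function.uncurry f)) {K : Set (H n)} (hK : IsCompact K)
    (hsupp : ∀ t, tsupport (f t) ⊆ K) (h0 : f 0 = 0) :
    ∀ᶠ t in 𝓝 0, ∃ ρ : CSContactomorphism n,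
      ∀ q, ρ.toFun (q + sourceShift (f t) q) = q + targetShift (f t) q := by
  have hd0 (p : H n) : fderiv ℝ (f 0) p = 0 := by rw [h0]; simp
  have hz0 (p : H n) : partialZ (f 0) p = 0 := by simp [partialZ, hd0]
  have hd (t : ℝ) (p : H n) (hp : p ∉ K) : fderiv ℝ (f t) p = 0 :=
    fderiv_of_notMem_tsupport ℝ fun h => hp (hsupp t h)
  have hz : ∀ᶠ t in 𝓝 (0 : ℝ), ∀ p ∈ K, 1 + partialZ (f t) p ≠ 0 := by
    refine hK.eventually_forall_of_forall_eventually fun p _ => ?_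
    have hc : Continuous fun q : ℝ × H n => 1 + partialZ (f q.1) q.2 :=
      continuous_const.add (contDiff_partialZ_family hf).continuous
    exact hc.continuousAt.eventually_ne (by simp [hz0])
  have hA := eventually_norm_fderiv_le (u := fun t => sourceShift (f t)) hK
    (fun p => (contDiffAt_sourceShift_family hf (q := (0, p)) (by simp [hz0])).of_le (by simp))
    (fun p => sourceShift_eq_zero (hd0 p)) (fun t p hp => sourceShift_eq_zero (hd t p hp))
    (ε := 1 / 2) (by norm_num)
  have hB := eventually_norm_fderiv_le (u := fun t => targetShift (f t)) hK
    (fun p => (contDiff_targetShift_family hf).contDiffAt.of_le (by simp))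
    (fun p => targetShift_eq_zero (by simp [h0]) (hd0 p))
    (fun t p hp => targetShift_eq_zero
      (image_eq_zero_of_notMem_tsupport fun h => hp (hsupp t h)) (hd t p hp))
    (ε := 1 / 2) (by norm_num)
  filter_upwards [hz, hA, hB] with t hzt hAt hBt
  refine exists_csContactomorphism_of_generating (hf.comp (contDiff_prodMk_right t))
    (hK.of_isClosed_subset (isClosed_tsupport _) (hsupp t)) (fun p => ?_) hAt hBt
  by_cases hp : p ∈ K
  · exact hzt p hp
  · simp [partialZ, hd t p hp]

end GeneratingFunction

section Dilation

variable {n : ℕ}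

/-- The dilation `(x, y, z) ↦ (t x, t y, t² z)` of the Heisenberg group. -/
noncomputable def dilation (t : ℝ) : H n →L[ℝ] H n :=
  (t • ContinuousLinearMap.id ℝ _).prodMap
    ((t • ContinuousLinearMap.id ℝ _).prodMap (t ^ 2 • ContinuousLinearMap.id ℝ ℝ))

theorem dilation_apply (t : ℝ) (p : H n) :
    dilation t p = (t • p.1, t • p.2.1, t ^ 2 * p.2.2) := rfl

theorem dilation_dilation_inv {t : ℝ} (ht : t ≠ 0) (p : H n) :
    dilation t (dilation t⁻¹ p) = p := by
  simp [dilation_apply, ht]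

theorem dilation_inv_dilation {t : ℝ} (ht : t ≠ 0) (p : H n) :
    dilation t⁻¹ (dilation t p) = p := by
  simp [dilation_apply, ht]

theorem dilation_hmul (t : ℝ) (p q : H n) :
    dilation t (hmul p q) = hmul (dilation t p) (dilation t q) := by
  simp only [hmul, sum_mul_eq_inner, dilation_apply, smul_add, real_inner_smul_left,
    real_inner_smul_right]
  congr 2
  ring

theorem alpha0_dilation (t : ℝ) (p ζ : H n) :
    alpha0 (dilation t p) (dilation t ζ) = t ^ 2 * alpha0 p ζ := by
  simp only [alpha0_eq, dilation_apply, real_inner_smul_left, real_inner_smul_right]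
  ring

/-- The conjugate of a compactly supported contactomorphism by a dilation. -/
noncomputable def CSContactomorphism.conjDilation (φ : CSContactomorphism n) {t : ℝ}
    (ht : t ≠ 0) : CSContactomorphism n where
  toFun p := dilation t⁻¹ (φ.toFun (dilation t p))
  invFun p := dilation t⁻¹ (φ.invFun (dilation t p))
  left_inv p := by simp [dilation_dilation_inv ht, dilation_inv_dilation ht, φ.left_inv _]
  right_inv p := by simp [dilation_dilation_inv ht, dilation_inv_dilation ht, φ.right_inv _]
  smooth := (dilation t⁻¹).contDiff.comp (φ.smooth.comp (dilation t).contDiff)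
  smooth_inv := (dilation t⁻¹).contDiff.comp (φ.smooth_inv.comp (dilation t).contDiff)
  compactSupp := by
    refine (φ.compactSupp.image (dilation t⁻¹).continuous).of_isClosed_subset isClosed_closure
      (closure_minimal (fun p hp => ?_)
        (φ.compactSupp.image (dilation t⁻¹).continuous).isClosed)
    refine ⟨dilation t p, subset_closure fun h => hp ?_, dilation_inv_dilation ht p⟩
    rw [h, dilation_inv_dilation ht]
  contact p ζ hζ := by
    have hφ := (φ.smooth.differentiable (by simp) (dilation t p)).hasFDerivAt
    have h := (dilation t⁻¹).hasFDerivAt.comp p (hφ.comp p (dilation t).hasFDerivAt)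
    have h' : fderiv ℝ (fun p => dilation t⁻¹ (φ.toFun (dilation t p))) p = _ := h.fderiv
    rw [h']
    change alpha0 (dilation t⁻¹ _) (dilation t⁻¹ (fderiv ℝ φ.toFun _ (dilation t ζ))) = 0
    rw [alpha0_dilation, φ.contact _ _ (by rw [alpha0_dilation, hζ, mul_zero]), mul_zero]

end Dilation

section Translation

variable {n : ℕ}

/-- The generating function of right translation by `dilation t x`. -/
noncomputable def translationGenerator (x : H n) (t : ℝ) (p : H n) : ℝ :=
  t * (⟪x.2.1, p.1⟫_ℝ - ⟪x.1, p.2.1⟫_ℝ) + t ^ 2 * x.2.2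

theorem contDiff_translationGenerator (x : H n) :
    ContDiff ℝ ∞ (Function.uncurry (translationGenerator x)) := by
  have h1 : ContDiff ℝ ∞ fun q : ℝ × H n => ⟪x.2.1, q.2.1⟫_ℝ :=
    contDiff_const.inner ℝ (by fun_prop)
  have h2 : ContDiff ℝ ∞ fun q : ℝ × H n => ⟪x.1, q.2.2.1⟫_ℝ :=
    contDiff_const.inner ℝ (by fun_prop)
  exact (contDiff_fst.mul (h1.sub h2)).add ((contDiff_fst.pow 2).mul contDiff_const)

theorem fderiv_translationGenerator (x : H n) (t : ℝ) (p ζ : H n) :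
    fderiv ℝ (translationGenerator x t) p ζ = t * (⟪x.2.1, ζ.1⟫_ℝ - ⟪x.1, ζ.2.1⟫_ℝ) := by
  have h1 : HasFDerivAt (fun q : H n => ⟪x.2.1, q.1⟫_ℝ) _ p :=
    (innerSL ℝ x.2.1).hasFDerivAt.comp p hasFDerivAt_fst
  have h2 : HasFDerivAt (fun q : H n => ⟪x.1, q.2.1⟫_ℝ) _ p :=
    (innerSL ℝ x.1).hasFDerivAt.comp p (hasFDerivAt_snd (p := p)).fst
  have h : HasFDerivAt (translationGenerator x t) _ p :=
    ((h1.sub h2).const_mul t).add_const (t ^ 2 * x.2.2)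
  rw [h.fderiv]
  rfl

theorem shift_of_eventuallyEq_translationGenerator {f : H n → ℝ} {x : H n} {t : ℝ} {p : H n}
    (h : f =ᶠ[𝓝 p] translationGenerator x t) :
    sourceShift f p = (0, -(t • x.2.1), 0) ∧
      targetShift f p = (t • x.1, 0, t * ⟪x.2.1, p.1⟫_ℝ + t ^ 2 * x.2.2) := by
  have hX : gradX f p = t • x.2.1 := by
    ext i; simp [gradX, h.fderiv_eq, fderiv_translationGenerator, ← sum_mul_eq_inner]
  have hY : gradY f p = -(t • x.1) := by
    ext i; simp [gradY, h.fderiv_eq, fderiv_translationGenerator, ← sum_mul_eq_inner]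
  have hZ : partialZ f p = 0 := by
    simp [partialZ, h.fderiv_eq, fderiv_translationGenerator]
  refine ⟨by simp [sourceShift, hX, hZ], ?_⟩
  simp only [targetShift, hY, h.eq_of_nhds, translationGenerator, inner_neg_right,
    real_inner_smul_right, real_inner_comm x.1 p.2.1, neg_neg]
  congr 2
  ring

/-- Right translation by `dilation t x` on the unit ball extends to a compactly supported
contactomorphism for all small `t`. -/
theorem eventually_exists_csContactomorphism_translation (x : H n) :
    ∀ᶠ t in 𝓝 (0 : ℝ), ∃ ρ : CSContactomorphism n,
      ∀ y ∈ Metric.ball (0 : H n) 1, ρ.toFun y = hmul y (dilation t x) := by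
  let χ : ContDiffBump (0 : H n) := ⟨2, 3, by norm_num, by norm_num⟩
  let f : ℝ → H n → ℝ := fun t p => χ p * translationGenerator x t p
  have hf : ContDiff ℝ ∞ (Function.uncurry f) :=
    (χ.contDiff.comp contDiff_snd).mul (contDiff_translationGenerator x)
  have hlim : Tendsto (fun t : ℝ => ‖((0, t • x.2.1, 0) : H n)‖) (𝓝 0) (𝓝 0) := by
    have hc : Continuous fun t : ℝ => ‖((0, t • x.2.1, 0) : H n)‖ := by fun_prop
    simpa using hc.tendsto 0
  filter_upwards [eventually_exists_csContactomorphism hf χ.hasCompactSupport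
      (fun t => tsupport_mul_subset_left) (by ext p; simp [f, translationGenerator]),
    hlim.eventually_lt_const zero_lt_one] with t ⟨ρ, hρ⟩ ht
  refine ⟨ρ, fun y hy => ?_⟩
  let q : H n := y + (0, t • x.2.1, 0)
  have hq : q ∈ Metric.ball (0 : H n) 2 := by
    rw [mem_ball_zero_iff] at hy ⊢
    linarith [norm_add_le y (0, t • x.2.1, 0)]
  have heq : f t =ᶠ[𝓝 q] translationGenerator x t := by
    filter_upwards [Metric.isOpen_ball.mem_nhds hq] with p hp
    simp [f, χ.one_of_mem_closedBall (Metric.ball_subset_closedBall hp)]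
  obtain ⟨hs, ht⟩ := shift_of_eventuallyEq_translationGenerator heq
  have hyq : q + sourceShift (f t) q = y := by
    rw [hs]; simp [q, add_assoc]
  rw [← hyq, hρ, hyq, ht, hmul, sum_mul_eq_inner, dilation_apply]
  simp only [q, Prod.fst_add, Prod.snd_add, real_inner_smul_right, add_zero,
    real_inner_comm x.2.1 y.1, Prod.ext_iff]
  refine ⟨trivial, trivial, by ring⟩

end Translation

/-- Right translation by any `x` in the Heisenberg group can be realized, on the
ball `B(0,r)`, by a compactly supported contactomorphism of `(ℝ²ⁿ⁺¹, ker α₀)`. -/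
theorem exists_csContactomorphism_translation
    (n : ℕ) (hn : 1 ≤ n) (x : H n) (r : ℝ) (hr : 0 < r) :
    ∃ ρ : CSContactomorphism n,
      ∀ y ∈ Metric.ball (0 : H n) r, ρ.toFun y = hmul y x := by
  have hball : ∀ᶠ t in 𝓝 (0 : ℝ),
      ∀ y ∈ Metric.closedBall (0 : H n) r, dilation t y ∈ Metric.ball (0 : H n) 1 := by
    refine (isCompact_closedBall (0 : H n) r).eventually_forall_of_forall_eventually fun y _ => ?_
    have hc : Continuous fun q : ℝ × H n => dilation q.1 q.2 := by
      simp only [dilation_apply]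
      fun_prop
    exact hc.continuousAt.eventually_mem (Metric.isOpen_ball.mem_nhds (by simp [dilation_apply]))
  obtain ⟨t, ⟨hbt, φ, hφ⟩, ht⟩ :=
    (((hball.and (eventually_exists_csContactomorphism_translation x)).filter_mono
      (nhdsWithin_le_nhds (s := {0}ᶜ))).and self_mem_nhdsWithin).exists
  refine ⟨φ.conjDilation ht, fun y hy => ?_⟩
  change dilation t⁻¹ (φ.toFun (dilation t y)) = _
  rw [hφ _ (hbt y (Metric.ball_subset_closedBall hy)), ← dilation_hmul, dilation_inv_dilation ht]
end

section
/- Let n ≥ 1 and k ≥ 1. For any pairwise distinct points p₁, …, p_k ∈ ℝ^{2n+1} and any pairwise distinct points q₁, …, q_k ∈ ℝ^{2n+1}, there exists a compactly supported contactomorphism γ of (ℝ^{2n+1}, ker α₀) with γ(pᵢ) = qᵢ for all i = 1, …, k. -/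
open MeasureTheory

open Set Filter Topology Function
open scoped ContDiff NNReal

theorem exists_equiv_contDiff_symm_of_fderiv_sub_id_le {E : Type*} [NormedAddCommGroup E]
    [NormedSpace ℝ E] [CompleteSpace E] {h : E → E} (hs : ContDiff ℝ ∞ h)
    (hle : ∀ P, ‖fderiv ℝ (fun x => h x - x) P‖ ≤ 1 / 2) :
    ∃ e : E ≃ E, ⇑e = h ∧ ContDiff ℝ ∞ e.symm := by
  rcases subsingleton_or_nontrivial E with hE | hE
  · exact ⟨Equiv.refl E, Subsingleton.elim _ _, contDiff_id⟩
  have hlip : LipschitzWith (1 / 2) (fun x => h x - x) :=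
    lipschitzWith_of_nnnorm_fderiv_le ((hs.sub contDiff_id).differentiable (by simp))
      fun P => by simpa [← NNReal.coe_le_coe] using hle P
  have happ : ApproximatesLinearOn h (ContinuousLinearEquiv.refl ℝ E : E →L[ℝ] E) univ (1 / 2) :=
    (hlip.lipschitzOnWith (s := univ)).approximatesLinearOn
  let e : E ≃ₜ E := happ.toHomeomorph _ (Or.inr (by
    have h1 : ‖((ContinuousLinearEquiv.refl ℝ E).symm : E →L[ℝ] E)‖₊ = 1 :=
      NNReal.eq ContinuousLinearMap.norm_id
    rw [h1, ← NNReal.coe_lt_coe]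
    norm_num))
  have he : ⇑e = h := rfl
  have hd (P : E) : ∃ A : E ≃L[ℝ] E, HasFDerivAt e (A : E →L[ℝ] E) P := by
    have hlt : ‖-fderiv ℝ (fun x => h x - x) P‖ < 1 := by
      rw [norm_neg]
      linarith [hle P]
    refine ⟨ContinuousLinearEquiv.unitsEquiv ℝ E (Units.oneSub _ hlt), ?_⟩
    have h2 : HasFDerivAt (fun x => h x - x) (fderiv ℝ (fun x => h x - x) P) P :=
      ((hs.sub contDiff_id).differentiable (by simp) P).hasFDerivAt
    convert (hasFDerivAt_id P).add h2 using 1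
    · ext x
      simp [he]
    · ext x
      simp [Units.oneSub]
  choose A hA using hd
  exact ⟨e.toEquiv, he, e.contDiff_symm hA (he ▸ hs)⟩

theorem IsCompact.eventually_forall_norm_le {S E F : Type*} [TopologicalSpace S]
    [TopologicalSpace E] [SeminormedAddCommGroup F] {N : S → E → F} {K : Set E} (hK : IsCompact K)
    {s₀ : S} (hc : ∀ P, ContinuousAt (uncurry N) (s₀, P)) (h0 : ∀ P, N s₀ P = 0)
    (hoff : ∀ s, ∀ P ∉ K, N s P = 0) {ε : ℝ} (hε : 0 < ε) :
    ∀ᶠ s in 𝓝 s₀, ∀ P, ‖N s P‖ ≤ ε := by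
  have h1 : ∀ᶠ s in 𝓝 s₀, ∀ P ∈ K, ‖N s P‖ < ε :=
    hK.eventually_forall_of_forall_eventually fun P _ =>
      (hc P).norm.eventually_lt_const (by simpa [uncurry, h0] using hε)
  filter_upwards [h1] with s hs P
  by_cases hP : P ∈ K
  · exact (hs P hP).le
  · simpa [hoff s P hP] using hε.le

/-- A permutation of `ℝ²ⁿ⁺¹` is a compactly supported contactomorphism. Contact vectors are
required to be reflected as well as preserved, which makes closure under inverses immediate. -/
structure IsCSContacto {n : ℕ} (e : Equiv.Perm (H n)) : Prop where
  smooth : ContDiff ℝ ∞ e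
  smooth_symm : ContDiff ℝ ∞ e.symm
  compactSupp : IsCompact (closure {p | e p ≠ p})
  contact_iff : ∀ p ζ, alpha0 (e p) (fderiv ℝ e p ζ) = 0 ↔ alpha0 p ζ = 0

namespace IsCSContacto

variable {n : ℕ} {e e' : Equiv.Perm (H n)}

theorem one : IsCSContacto (1 : Equiv.Perm (H n)) where
  smooth := contDiff_id
  smooth_symm := contDiff_id
  compactSupp := by simp
  contact_iff p ζ := by
    have : ⇑(1 : Equiv.Perm (H n)) = id := rfl
    simp [this]

theorem mul (h : IsCSContacto e) (h' : IsCSContacto e') : IsCSContacto (e * e') where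
  smooth := h.smooth.comp h'.smooth
  smooth_symm := h'.smooth_symm.comp h.smooth_symm
  compactSupp := by
    refine (h.compactSupp.union h'.compactSupp).of_isClosed_subset isClosed_closure ?_
    rw [← closure_union]
    refine closure_mono fun p hp => ?_
    by_contra hc
    simp only [mem_union, mem_ofPred_eq, not_or, not_not] at hc
    exact hp (by simp [hc.1, hc.2])
  contact_iff p ζ := by
    rw [Equiv.Perm.coe_mul, fderiv_comp _ (h.smooth.differentiable (by simp) _)
      (h'.smooth.differentiable (by simp) _)]
    exact (h.contact_iff _ _).trans (h'.contact_iff _ _)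

theorem fderiv_symm_apply (h : ContDiff ℝ ∞ e) (hs : ContDiff ℝ ∞ e.symm) (p ζ : H n) :
    fderiv ℝ e (e.symm p) (fderiv ℝ e.symm p ζ) = ζ := by
  have h1 := fderiv_comp p (h.differentiable (by simp) (e.symm p))
    (hs.differentiable (by simp) p)
  rw [e.self_comp_symm, fderiv_id] at h1
  exact (DFunLike.congr_fun h1 ζ).symm

theorem symm (h : IsCSContacto e) : IsCSContacto e.symm where
  smooth := h.smooth_symm
  smooth_symm := h.smooth
  compactSupp := by
    convert h.compactSupp using 4 with p
    rw [ne_eq, e.symm_apply_eq, eq_comm]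
  contact_iff p ζ := by
    rw [← h.contact_iff, fderiv_symm_apply h.smooth h.smooth_symm, e.apply_symm_apply]

end IsCSContacto

section Gradient

variable {n : ℕ}

/-- The vector `(L (j eᵢ))ᵢ` representing the restriction of a covector `L` along `j`. -/
noncomputable def grad (j : EuclideanSpace ℝ (Fin n) →L[ℝ] H n) :
    (H n →L[ℝ] ℝ) →L[ℝ] EuclideanSpace ℝ (Fin n) :=
  ∑ i, (ContinuousLinearMap.apply ℝ ℝ (j (EuclideanSpace.single i 1))).smulRight
    (EuclideanSpace.single i 1)

theorem grad_apply (j : EuclideanSpace ℝ (Fin n) →L[ℝ] H n) (L : H n →L[ℝ] ℝ) (i : Fin n) :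
    grad j L i = L (j (EuclideanSpace.single i 1)) := by
  simp [grad, Pi.single_apply]

theorem grad_eq_of_forall_inner {j : EuclideanSpace ℝ (Fin n) →L[ℝ] H n} {L : H n →L[ℝ] ℝ}
    {w : EuclideanSpace ℝ (Fin n)} (h : ∀ u, L (j u) = inner ℝ w u) : grad j L = w := by
  ext i
  simp [grad_apply, h, EuclideanSpace.inner_single_right]

theorem sum_mul_grad (j : EuclideanSpace ℝ (Fin n) →L[ℝ] H n) (L : H n →L[ℝ] ℝ)
    (u : EuclideanSpace ℝ (Fin n)) : ∑ i, u i * grad j L i = L (j u) := by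
  have hu : u = ∑ i, u i • EuclideanSpace.single i (1 : ℝ) := by
    ext i
    simp [Pi.single_apply]
  conv_rhs => rw [hu]
  simp [grad_apply]

end Gradient

section GeneratingFunction

variable {n : ℕ}

/-- The inclusion of the `x`-directions. -/
noncomputable def inclX (n : ℕ) : EuclideanSpace ℝ (Fin n) →L[ℝ] H n :=
  .inl ℝ _ _

/-- The inclusion of the `y`-directions. -/
noncomputable def inclY (n : ℕ) : EuclideanSpace ℝ (Fin n) →L[ℝ] H n :=
  (ContinuousLinearMap.inr ℝ _ _).comp (.inl ℝ _ _)

/-- The inclusion of the `z`-direction. -/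
noncomputable def inclZ (n : ℕ) : ℝ →L[ℝ] H n :=
  (ContinuousLinearMap.inr ℝ _ _).comp (.inr ℝ _ _)

theorem map_eq_add_add (L : H n →L[ℝ] ℝ) (v : H n) :
    L v = L (inclX n v.1) + L (inclY n v.2.1) + v.2.2 * L (inclZ n 1) := by
  rw [← smul_eq_mul v.2.2, ← map_smul, ← map_smul, ← map_add, ← map_add]
  congr 1
  ext <;> simp [inclX, inclY, inclZ]

/-- The source `(x, y, z)` of the contactomorphism with generating function
`z - ⟨Y, x⟩ + f (x, Y, z)`, at the point `P = (x, Y, z)`, where `L = df(P)`. -/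
noncomputable def genSource (L : H n →L[ℝ] ℝ) (P : H n) : H n :=
  (P.1, (1 + L (inclZ n 1))⁻¹ • (P.2.1 - grad (inclX n) L), P.2.2)

/-- The target `(X, Y, Z)` of the contactomorphism with generating function
`z - ⟨Y, x⟩ + f (x, Y, z)`, at the point `P = (x, Y, z)`, where `c = f(P)` and `L = df(P)`. -/
noncomputable def genTarget (c : ℝ) (L : H n →L[ℝ] ℝ) (P : H n) : H n :=
  (P.1 - grad (inclY n) L, P.2.1, P.2.2 + c - L (inclY n P.2.1))

theorem genSource_zero (P : H n) : genSource 0 P = P := by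
  simp [genSource]

theorem genTarget_zero (P : H n) : genTarget 0 0 P = P := by
  simp [genTarget]

variable {X : Type*} [NormedAddCommGroup X] [NormedSpace ℝ X] {c : X → ℝ}
  {L : X → H n →L[ℝ] ℝ} {P : X → H n} {x : X}

theorem ContDiffAt.genSource (hL : ContDiffAt ℝ ∞ L x) (hP : ContDiffAt ℝ ∞ P x)
    (h : 1 + L x (inclZ n 1) ≠ 0) : ContDiffAt ℝ ∞ (fun x => genSource (L x) (P x)) x := by
  have h1 : ContDiffAt ℝ ∞ (fun x => 1 + L x (inclZ n 1)) x :=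
    contDiffAt_const.add (hL.clm_apply contDiffAt_const)
  have h2 : ContDiffAt ℝ ∞ (fun x => (P x).2.1 - grad (inclX n) (L x)) x :=
    hP.snd.fst.sub ((grad (inclX n)).contDiff.contDiffAt.comp x hL)
  exact hP.fst.prodMk (((h1.inv h).smul h2).prodMk hP.snd.snd)

theorem ContDiffAt.genTarget (hc : ContDiffAt ℝ ∞ c x) (hL : ContDiffAt ℝ ∞ L x)
    (hP : ContDiffAt ℝ ∞ P x) : ContDiffAt ℝ ∞ (fun x => genTarget (c x) (L x) (P x)) x := by
  refine ContDiffAt.prodMk ?_ (hP.snd.fst.prodMk ?_)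
  · exact hP.fst.sub (((grad (inclY n)).contDiff.contDiffAt).comp x hL)
  · exact (hP.snd.snd.add hc).sub
      (hL.clm_apply (((inclY n).contDiff.contDiffAt).comp x hP.snd.fst))

theorem alpha0_fderiv_genTarget {f : H n → ℝ} (hf : ContDiff ℝ ∞ f)
    {P : H n} (hz : 1 + fderiv ℝ f P (inclZ n 1) ≠ 0) (v : H n) :
    alpha0 (genTarget (f P) (fderiv ℝ f P) P)
        (fderiv ℝ (fun Q => genTarget (f Q) (fderiv ℝ f Q) Q) P v) =
      (1 + fderiv ℝ f P (inclZ n 1)) * alpha0 (genSource (fderiv ℝ f P) P)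
        (fderiv ℝ (fun Q => genSource (fderiv ℝ f Q) Q) P v) := by
  have hf' : ContDiff ℝ ∞ (fderiv ℝ f) := hf.fderiv_right (by simp)
  have hd : HasFDerivAt f (fderiv ℝ f P) P := (hf.differentiable (by simp) P).hasFDerivAt
  have hd' : HasFDerivAt (fderiv ℝ f) (fderiv ℝ (fderiv ℝ f) P) P :=
    (hf'.differentiable (by simp) P).hasFDerivAt
  have hx : HasFDerivAt (fun Q : H n => Q.1) (.fst ℝ _ _) P := hasFDerivAt_fst
  have hyz : HasFDerivAt (fun Q : H n => Q.2) (.snd ℝ _ _) P := hasFDerivAt_snd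
  have ht : HasFDerivAt (fun Q => genTarget (f Q) (fderiv ℝ f Q) Q) _ P :=
    (hx.sub ((grad (inclY n)).hasFDerivAt.comp P hd')).prodMk (hyz.fst.prodMk
      ((hyz.snd.add hd).sub (hd'.clm_apply ((inclY n).hasFDerivAt.comp P hyz.fst))))
  have hm : DifferentiableAt ℝ (fun Q => (genSource (fderiv ℝ f Q) Q).2.1) P :=
    ((hf'.contDiffAt.genSource contDiffAt_id hz).snd.fst).differentiableAt (by simp)
  have hs : HasFDerivAt (fun Q => genSource (fderiv ℝ f Q) Q) _ P :=
    hx.prodMk (hm.hasFDerivAt.prodMk hyz.snd)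
  have h1 := sum_mul_grad (inclY n) (fderiv ℝ (fderiv ℝ f) P v) P.2.1
  have h2 := sum_mul_grad (inclX n) (fderiv ℝ f P) v.1
  have h3 := map_eq_add_add (fderiv ℝ f P) v
  have h4 : ∑ i, (genSource (fderiv ℝ f P) P).2.1 i * v.1 i =
      (1 + fderiv ℝ f P (inclZ n 1))⁻¹ *
        (∑ i, P.2.1 i * v.1 i - fderiv ℝ f P (inclX n v.1)) := by
    simp only [← h2, genSource, PiLp.smul_apply, PiLp.sub_apply, smul_eq_mul,
      ← Finset.sum_sub_distrib, Finset.mul_sum]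
    exact Finset.sum_congr rfl fun i _ => by ring
  have h5 : alpha0 (genSource (fderiv ℝ f P) P)
      (fderiv ℝ (fun Q => genSource (fderiv ℝ f Q) Q) P v) =
      v.2.2 - ∑ i, (genSource (fderiv ℝ f P) P).2.1 i * v.1 i := by
    rw [hs.fderiv]
    rfl
  rw [h5, h4, mul_sub, mul_inv_cancel_left₀ hz, ht.fderiv]
  simp only [alpha0, genTarget, mul_sub, Finset.sum_sub_distrib, h1,
    ContinuousLinearMap.prod_apply, sub_apply, add_apply, ContinuousLinearMap.comp_apply,
    ContinuousLinearMap.coe_fst', ContinuousLinearMap.coe_snd', PiLp.sub_apply,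
    ContinuousLinearMap.flip_apply]
  rw [h3]
  ring

theorem exists_isCSContacto_of_generating {f : H n → ℝ} (hf : ContDiff ℝ ∞ f)
    (hK : HasCompactSupport f) (hz : ∀ P, 1 + fderiv ℝ f P (inclZ n 1) ≠ 0)
    (hs : ∀ P, ‖fderiv ℝ (fun Q => genSource (fderiv ℝ f Q) Q - Q) P‖ ≤ 1 / 2)
    (ht : ∀ P, ‖fderiv ℝ (fun Q => genTarget (f Q) (fderiv ℝ f Q) Q - Q) P‖ ≤ 1 / 2) :
    ∃ e : Equiv.Perm (H n), IsCSContacto e ∧ (∀ p ∉ tsupport f, e p = p) ∧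
      ∀ P, e (genSource (fderiv ℝ f P) P) = genTarget (f P) (fderiv ℝ f P) P := by
  have hf' : ContDiff ℝ ∞ (fderiv ℝ f) := hf.fderiv_right (by simp)
  have hsS : ContDiff ℝ ∞ (fun Q => genSource (fderiv ℝ f Q) Q) :=
    contDiff_iff_contDiffAt.2 fun P => hf'.contDiffAt.genSource contDiffAt_id (hz P)
  have hsT : ContDiff ℝ ∞ (fun Q => genTarget (f Q) (fderiv ℝ f Q) Q) :=
    contDiff_iff_contDiffAt.2 fun P => hf.contDiffAt.genTarget hf'.contDiffAt contDiffAt_id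
  obtain ⟨a, ha, ha'⟩ := exists_equiv_contDiff_symm_of_fderiv_sub_id_le hsS hs
  obtain ⟨b, hb, hb'⟩ := exists_equiv_contDiff_symm_of_fderiv_sub_id_le hsT ht
  have ha₁ (P : H n) : a P = genSource (fderiv ℝ f P) P := congrFun ha P
  have hb₁ (P : H n) : b P = genTarget (f P) (fderiv ℝ f P) P := congrFun hb P
  rw [← ha] at hsS
  rw [← hb] at hsT
  have hoff : ∀ p ∉ tsupport f, b (a.symm p) = p := by
    intro p hp
    have h0 : f p = 0 := image_eq_zero_of_notMem_tsupport hp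
    have h1 : fderiv ℝ f p = 0 :=
      image_eq_zero_of_notMem_tsupport fun h => hp (tsupport_fderiv_subset ℝ h)
    have h2 : a.symm p = p := by
      rw [a.symm_apply_eq, ha₁, h1, genSource_zero]
    rw [h2, hb₁, h0, h1, genTarget_zero]
  refine ⟨a.symm.trans b, ⟨hsT.comp ha', hsS.comp hb', ?_, fun p ζ => ?_⟩, hoff, fun P => ?_⟩
  · refine IsCompact.of_isClosed_subset hK isClosed_closure
      (closure_minimal (fun p hp => ?_) isClosed_closure)
    by_contra hc
    exact hp (hoff p hc)
  · obtain ⟨P, rfl⟩ := a.surjective p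
    have h1 := alpha0_fderiv_genTarget hf (hz P) (fderiv ℝ a.symm (a P) ζ)
    have h2 := IsCSContacto.fderiv_symm_apply hsS ha' (a P) ζ
    rw [a.symm_apply_apply] at h2
    rw [Equiv.coe_trans, fderiv_comp _ (hsT.differentiable (by simp) _)
      (ha'.differentiable (by simp) _), comp_apply, a.symm_apply_apply]
    rw [← ha, ← hb, h2, ← ha₁, ← hb₁] at h1
    rw [ContinuousLinearMap.comp_apply, h1, mul_eq_zero, or_iff_right (hz P)]
  · simp [← ha₁, ← hb₁]

end GeneratingFunction

section Transitivity

variable {n : ℕ}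

/-- The cut-off of the function generating a contactomorphism which maps `p` to `q`. -/
noncomputable def genFun (χ : H n → ℝ) (p q P : H n) : ℝ :=
  χ P * (q.2.2 - p.2.2 + inner ℝ (q.2.1 - p.2.1) (P.1 - p.1) + inner ℝ (p.1 - q.1) P.2.1)

theorem genFun_self (χ : H n → ℝ) (p P : H n) : genFun χ p p P = 0 := by
  simp [genFun]

theorem contDiff_uncurry_genFun {χ : H n → ℝ} (hχ : ContDiff ℝ ∞ χ) (p : H n) :
    ContDiff ℝ ∞ (uncurry (genFun χ p)) := by
  have h1 : ContDiff ℝ ∞ (fun z : H n × H n => z.1) := contDiff_fst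
  have h2 : ContDiff ℝ ∞ (fun z : H n × H n => z.2) := contDiff_snd
  exact (hχ.comp h2).mul (((h1.snd.snd.sub contDiff_const).add
    ((h1.snd.fst.sub contDiff_const).inner ℝ (h2.fst.sub contDiff_const))).add
    ((contDiff_const.sub h1.fst).inner ℝ h2.snd.fst))

theorem tsupport_genFun_subset (χ : H n → ℝ) (p q : H n) :
    tsupport (genFun χ p q) ⊆ tsupport χ :=
  tsupport_mul_subset_left

theorem eventually_exists_isCSContacto_genFun {χ : H n → ℝ} (hχ : ContDiff ℝ ∞ χ)
    (hK : HasCompactSupport χ) (p : H n) :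
    ∀ᶠ q in 𝓝 p, ∃ e : Equiv.Perm (H n), IsCSContacto e ∧ (∀ x ∉ tsupport χ, e x = x) ∧
      ∀ P, e (genSource (fderiv ℝ (genFun χ p q) P) P) =
        genTarget (genFun χ p q P) (fderiv ℝ (genFun χ p q) P) P := by
  have hF := contDiff_uncurry_genFun hχ p
  have hL : ContDiff ℝ ∞ (fun z : H n × H n => fderiv ℝ (genFun χ p z.1) z.2) :=
    ContDiff.fderiv (f := fun z : H n × H n => genFun χ p z.1)
      (hF.comp (contDiff_fst.fst.prodMk contDiff_snd)) contDiff_snd (by simp)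
  have hL0 (P : H n) : fderiv ℝ (genFun χ p p) P = 0 := by
    rw [show genFun χ p p = fun _ => 0 from funext (genFun_self χ p)]
    simp
  have hoff (q : H n) : ∀ P ∉ tsupport χ, genFun χ p q =ᶠ[𝓝 P] fun _ => 0 := fun P hP =>
    notMem_tsupport_iff_eventuallyEq.1 fun h => hP (tsupport_genFun_subset χ p q h)
  have hLoff (q : H n) : ∀ P ∉ tsupport χ, fderiv ℝ (genFun χ p q) =ᶠ[𝓝 P] 0 :=
    fun P hP => by simpa using (hoff q P hP).fderiv
  have hz := hK.isCompact.eventually_forall_norm_le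
    (N := fun q P => fderiv ℝ (genFun χ p q) P (inclZ n 1)) (s₀ := p) (ε := 1 / 2)
    (fun P => (hL.clm_apply contDiff_const).continuous.continuousAt) (fun P => by simp [hL0])
    (fun q P hP => by simp [(hLoff q P hP).eq_of_nhds]) (by norm_num)
  have hs := hK.isCompact.eventually_forall_norm_le
    (N := fun q => fderiv ℝ fun P => genSource (fderiv ℝ (genFun χ p q) P) P - P)
    (s₀ := p) (ε := 1 / 2) (fun P => by
      have h1 : ContDiffAt ℝ ∞ (uncurry fun q P =>
          genSource (fderiv ℝ (genFun χ p q) P) P - P) (p, P) :=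
        (hL.contDiffAt.genSource contDiffAt_snd (by simp [hL0])).sub contDiffAt_snd
      exact (ContDiffAt.fderiv (m := ∞) (x₀ := (p, P))
        (f := fun z : H n × H n => fun P => genSource (fderiv ℝ (genFun χ p z.1) P) P - P)
        (h1.comp ((p, P), P) (contDiffAt_fst.fst.prodMk contDiffAt_snd)) contDiffAt_snd
        (by simp)).continuousAt)
    (fun P => by simp [hL0, genSource_zero])
    (fun q P hP => by
      have h1 : (fun P => genSource (fderiv ℝ (genFun χ p q) P) P - P) =ᶠ[𝓝 P] fun _ => 0 := by
        filter_upwards [hLoff q P hP] with Q hQ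
        rw [hQ, Pi.zero_apply, genSource_zero, sub_self]
      simp [h1.fderiv_eq]) (by norm_num)
  have ht := hK.isCompact.eventually_forall_norm_le
    (N := fun q => fderiv ℝ fun P =>
      genTarget (genFun χ p q P) (fderiv ℝ (genFun χ p q) P) P - P)
    (s₀ := p) (ε := 1 / 2) (fun P => by
      have h1 : ContDiffAt ℝ ∞ (uncurry fun q P =>
          genTarget (genFun χ p q P) (fderiv ℝ (genFun χ p q) P) P - P) (p, P) :=
        (hF.contDiffAt.genTarget hL.contDiffAt contDiffAt_snd).sub contDiffAt_snd
      exact (ContDiffAt.fderiv (m := ∞) (x₀ := (p, P))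
        (f := fun z : H n × H n => fun P =>
          genTarget (genFun χ p z.1 P) (fderiv ℝ (genFun χ p z.1) P) P - P)
        (h1.comp ((p, P), P) (contDiffAt_fst.fst.prodMk contDiffAt_snd)) contDiffAt_snd
        (by simp)).continuousAt)
    (fun P => by simp [hL0, genFun_self, genTarget_zero])
    (fun q P hP => by
      have h1 : (fun P => genTarget (genFun χ p q P) (fderiv ℝ (genFun χ p q) P) P - P)
          =ᶠ[𝓝 P] fun _ => 0 := by
        filter_upwards [hLoff q P hP, hoff q P hP] with Q hQ hQ'
        rw [hQ, hQ', Pi.zero_apply, genTarget_zero, sub_self]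
      simp [h1.fderiv_eq]) (by norm_num)
  filter_upwards [hz, hs, ht] with q hzq hsq htq
  have hz0 (P : H n) : 1 + fderiv ℝ (genFun χ p q) P (inclZ n 1) ≠ 0 := by
    have h1 := (abs_le.1 (hzq P)).1
    intro h
    linarith
  obtain ⟨e, he, heoff, hmap⟩ := exists_isCSContacto_of_generating
    (hF.comp (contDiff_const.prodMk contDiff_id))
    (hK.mono' (subset_closure.trans (tsupport_genFun_subset χ p q))) hz0 hsq htq
  exact ⟨e, he, fun x hx => heoff x fun h => hx (tsupport_genFun_subset χ p q h), hmap⟩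

theorem eventually_exists_isCSContacto_apply_eq {p : H n} {U : Set (H n)} (hU : U ∈ 𝓝 p) :
    ∀ᶠ q in 𝓝 p, ∃ e : Equiv.Perm (H n), IsCSContacto e ∧ (∀ x ∉ U, e x = x) ∧ e p = q := by
  obtain ⟨r, hr, hrU⟩ := Metric.nhds_basis_closedBall.mem_iff.1 hU
  let χ : ContDiffBump p := ⟨r / 2, r, half_pos hr, half_lt_self hr⟩
  have hP : Tendsto (fun q : H n => ((p.1, q.2.1, p.2.2) : H n)) (𝓝 p) (𝓝 p) :=
    Continuous.tendsto' (by fun_prop) _ _ rfl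
  filter_upwards [eventually_exists_isCSContacto_genFun χ.contDiff χ.hasCompactSupport p,
    hP.eventually χ.eventuallyEq_one.eventually_nhds] with q ⟨e, he, heoff, hmap⟩ hq
  refine ⟨e, he, fun x hx => heoff x fun h => hx (hrU (χ.tsupport_eq ▸ h)), ?_⟩
  set P : H n := (p.1, q.2.1, p.2.2)
  have hf : genFun χ p q =ᶠ[𝓝 P] fun Q => q.2.2 - p.2.2 + inner ℝ (q.2.1 - p.2.1) (Q.1 - p.1) +
      inner ℝ (p.1 - q.1) Q.2.1 := by
    filter_upwards [hq] with Q hQ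
    simp [genFun, hQ]
  obtain ⟨D, hDv⟩ : ∃ D : H n →L[ℝ] ℝ,
      ∀ v, D v = inner ℝ (q.2.1 - p.2.1) v.1 + inner ℝ (p.1 - q.1) v.2.1 :=
    ⟨(innerSL ℝ (q.2.1 - p.2.1)).comp (.fst ℝ _ _) +
      (innerSL ℝ (p.1 - q.1)).comp ((ContinuousLinearMap.fst ℝ _ _).comp (.snd ℝ _ _)),
      fun v => rfl⟩
  have hD : fderiv ℝ (genFun χ p q) P = D := by
    have h1 : (fun Q : H n => q.2.2 - p.2.2 + inner ℝ (q.2.1 - p.2.1) (Q.1 - p.1) +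
        inner ℝ (p.1 - q.1) Q.2.1) =
        fun Q : H n => (q.2.2 - p.2.2 - inner ℝ (q.2.1 - p.2.1) p.1) + D Q := by
      funext Q
      rw [hDv, inner_sub_right]
      ring
    rw [hf.fderiv_eq, h1, fderiv_const_add, D.fderiv]
  have hX : grad (inclX n) D = q.2.1 - p.2.1 :=
    grad_eq_of_forall_inner fun u => by simp [hDv, inclX]
  have hY : grad (inclY n) D = p.1 - q.1 :=
    grad_eq_of_forall_inner fun u => by simp [hDv, inclY]
  have hZ : D (inclZ n 1) = 0 := by simp [hDv, inclZ]
  have hsrc : genSource D P = p := by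
    simp [genSource, hX, hZ, P]
  have htgt : genTarget (genFun χ p q P) D P = q := by
    rw [hf.eq_of_nhds]
    have h1 : D (inclY n q.2.1) = inner ℝ (p.1 - q.1) q.2.1 := by simp [hDv, inclY]
    ext <;> simp [genTarget, hY, P, h1]
    ring
  rw [← hsrc, ← hD, hmap, hD, htgt]

theorem exists_isCSContacto_fixing (hn : 1 ≤ n) {S : Set (H n)} (hS : S.Finite) {p q : H n}
    (hp : p ∉ S) (hq : q ∉ S) :
    ∃ e : Equiv.Perm (H n), IsCSContacto e ∧ (∀ x ∈ S, e x = x) ∧ e p = q := by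
  have hrank : 1 < Module.rank ℝ (H n) := by
    rw [← Module.finrank_eq_rank, Nat.one_lt_cast]
    simp only [Module.finrank_prod, finrank_euclideanSpace, Fintype.card_fin, Module.finrank_self]
    omega
  have hconn := (hS.countable.isConnected_compl_of_one_lt_rank hrank).isPreconnected
  refine hconn.induction₂ (fun p q => ∃ e : Equiv.Perm (H n), IsCSContacto e ∧
    (∀ x ∈ S, e x = x) ∧ e p = q) (fun x hx => ?_) ?_ ?_ hp hq
  · refine nhdsWithin_le_nhds ?_
    filter_upwards [eventually_exists_isCSContacto_apply_eq
      (hS.isClosed.isOpen_compl.mem_nhds hx)] with y ⟨e, he, heS, hxy⟩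
    exact ⟨e, he, fun x hx => heS x (by simpa using hx), hxy⟩
  · rintro x y z - - - ⟨e, he, heS, rfl⟩ ⟨e', he', heS', rfl⟩
    exact ⟨e' * e, he'.mul he, fun x hx => by simp [heS x hx, heS' x hx], rfl⟩
  · rintro x y - - ⟨e, he, heS, rfl⟩
    exact ⟨e.symm, he.symm, fun x hx => by rw [e.symm_apply_eq, heS x hx], by simp⟩

theorem exists_isCSContacto_forall_apply_eq (hn : 1 ≤ n) {k : ℕ} {p q : Fin k → H n}
    (hp : Injective p) (hq : Injective q) :
    ∃ e : Equiv.Perm (H n), IsCSContacto e ∧ ∀ i, e (p i) = q i := by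
  induction k with
  | zero => exact ⟨1, .one, fun i => i.elim0⟩
  | succ k ih =>
    obtain ⟨e, he, hpq⟩ := ih (hp.comp (Fin.castSucc_injective k))
      (hq.comp (Fin.castSucc_injective k))
    obtain ⟨e', he', hfix, hlast⟩ := exists_isCSContacto_fixing hn
      (finite_range (q ∘ Fin.castSucc)) (p := e (p (Fin.last k))) (q := q (Fin.last k))
      (by
        rintro ⟨i, hi⟩
        rw [← hpq] at hi
        exact (Fin.castSucc_lt_last i).ne (hp (e.injective hi)))
      (by
        rintro ⟨i, hi⟩
        exact (Fin.castSucc_lt_last i).ne (hq hi))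
    refine ⟨e' * e, he'.mul he, fun i => ?_⟩
    induction i using Fin.lastCases with
    | last => exact hlast
    | cast i =>
      have h1 := hpq i
      simp only [comp_apply] at h1
      rw [Equiv.Perm.mul_apply, h1]
      exact hfix _ ⟨i, rfl⟩

end Transitivity

/-- The group of compactly supported contactomorphisms of `(ℝ²ⁿ⁺¹, ker α₀)` acts
`k`-transitively for every `k ≥ 1`. -/
theorem csContactomorphism_k_transitive
    (n : ℕ) (hn : 1 ≤ n) (k : ℕ) (hk : 1 ≤ k)
    (p q : Fin k → H n) (hp : Function.Injective p) (hq : Function.Injective q) :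
    ∃ γ : CSContactomorphism n, ∀ i, γ.toFun (p i) = q i := by
  obtain ⟨e, he, hpq⟩ := exists_isCSContacto_forall_apply_eq hn hp hq
  exact ⟨⟨e, e.symm, e.left_inv, e.right_inv, he.smooth, he.smooth_symm, he.compactSupp,
    fun p ζ => (he.contact_iff p ζ).2⟩, hpq⟩
end
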